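/- For all sufficiently large n, the following holds: if G is a simple graph on n vertices in which any two cycles have different lengths, and G has the maximum possible number of edges among all simple graphs on n vertices in which any two cycles have different lengths (i.e., G has f*(n) edges), then every cycle of G has length at most (15/16)·n. In other words, mc(n) ≤ (15/16)·n for all sufficiently large n. -/

import Mathlib

/-- A simple graph has no repeated cycle lengths if any two cycles of the same
length are in fact the same cycle (i.e., have the same edge set). -/
def NoRepeatedCycleLengths {V : Type*} (G : SimpleGraph V) : Prop :=
  ∀ (u v : V) (c₁ : G.Walk u u) (c₂ : G.Walk v v),
    c₁.IsCycle → c₂.IsCycle → c₁.length = c₂.length →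
      {e | e ∈ c₁.edges} = {e | e ∈ c₂.edges}

/-- In a finite family of subsets of `E` some `x` elements hit all but at most
`∑ (1 - |Z| / |E|) ^ x` members. -/
lemma exists_hitting_set {α : Type*} [DecidableEq α] (E : Finset α) (hE : E.Nonempty)
    (x : ℕ) (F : Finset (Finset α)) (hF : ∀ Z ∈ F, Z ⊆ E) :
    ∃ X ⊆ E, X.card ≤ x ∧ ((F.filter fun Z => Disjoint Z X).card : ℝ) ≤
      ∑ Z ∈ F, (1 - (Z.card : ℝ) / E.card) ^ x := by
  induction x generalizing F with
  | zero => exact ⟨∅, by simp, by simp, by simp⟩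
  | succ x ih =>
    have hEc : (0 : ℝ) < E.card := by exact_mod_cast hE.card_pos
    have havg : ∃ e ∈ E, (∑ Z ∈ F with e ∉ Z, (1 - (Z.card : ℝ) / E.card) ^ x) ≤
        ∑ Z ∈ F, (1 - (Z.card : ℝ) / E.card) ^ (x + 1) := by
      apply Finset.exists_le_of_sum_le hE
      simp_rw [Finset.sum_filter]
      rw [Finset.sum_comm, Finset.sum_const, nsmul_eq_mul, Finset.mul_sum]
      apply le_of_eq
      refine Finset.sum_congr rfl fun Z hZ => ?_
      rw [← Finset.sum_filter, Finset.sum_const, nsmul_eq_mul]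
      have : (E.filter fun e => e ∉ Z).card = E.card - Z.card := by
        rw [← Finset.card_sdiff_of_subset (hF Z hZ)]
        congr 1
        ext e
        simp
      rw [this, Nat.cast_sub (Finset.card_le_card (hF Z hZ)), pow_succ]
      field_simp
    obtain ⟨e, he, hle⟩ := havg
    obtain ⟨X, hXE, hXc, hX⟩ := ih (F.filter fun Z => e ∉ Z)
      (fun Z hZ => hF Z (Finset.mem_filter.1 hZ).1)
    refine ⟨insert e X, Finset.insert_subset he hXE,
      (Finset.card_insert_le _ _).trans (by omega), ?_⟩
    refine le_trans ?_ (hX.trans hle)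
    rw [Finset.filter_filter]
    apply le_of_eq
    congr 2
    ext Z
    simp [Finset.disjoint_insert_right]

lemma sum_one_sub_div_pow_le (N x : ℕ) (hN : 0 < N) (hx : 0 < x) :
    ∑ s ∈ Finset.Icc 1 N, (1 - (s : ℝ) / N) ^ x ≤ N / x := by
  have hN' : (0 : ℝ) < N := by exact_mod_cast hN
  have hx' : (0 : ℝ) < x := by exact_mod_cast hx
  set q : ℝ := (N : ℝ) / (N + x) with hq
  have hq0 : 0 ≤ q := by positivity
  have hq1 : q < 1 := by rw [hq, div_lt_one (by positivity)]; linarith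
  have key : ∀ s ∈ Finset.Icc 1 N, (1 - (s : ℝ) / N) ^ x ≤ q ^ s := by
    intro s hs
    rw [Finset.mem_Icc] at hs
    have hsN : (s : ℝ) ≤ N := by exact_mod_cast hs.2
    have h0 : 0 ≤ 1 - (s : ℝ) / N := by rw [sub_nonneg, div_le_one hN']; exact hsN
    have h1 : (1 - (s : ℝ) / N) ^ x ≤ Real.exp (-(x : ℝ) / N) ^ s := by
      calc (1 - (s : ℝ) / N) ^ x ≤ Real.exp (-((s : ℝ) / N)) ^ x :=
            pow_le_pow_left₀ h0 (Real.one_sub_le_exp_neg _) _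
        _ = Real.exp (-(x : ℝ) / N) ^ s := by
            rw [← Real.exp_nat_mul, ← Real.exp_nat_mul]
            congr 1
            ring
    refine h1.trans (pow_le_pow_left₀ (Real.exp_pos _).le ?_ _)
    have h2 : 1 + (x : ℝ) / N ≤ Real.exp ((x : ℝ) / N) := by
      have := Real.add_one_le_exp ((x : ℝ) / N); linarith
    rw [neg_div, Real.exp_neg, hq]
    have h3 : (N : ℝ) / (N + x) = (1 + (x : ℝ) / N)⁻¹ := by field_simp
    rw [h3]
    exact inv_anti₀ (by positivity) h2
  refine (Finset.sum_le_sum key).trans ?_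
  have h4 : ∑ s ∈ Finset.Icc 1 N, q ^ s ≤ q / (1 - q) := by
    have h5 : ∑ s ∈ Finset.Icc 1 N, q ^ s = q * ∑ s ∈ Finset.range N, q ^ s := by
      rw [Finset.mul_sum]
      refine Finset.sum_bij' (fun v _ => v - 1) (fun v _ => v + 1) ?_ ?_ ?_ ?_ ?_
      · simp; intros; omega
      · simp
      · simp; intros; omega
      · simp
      · intro v hv
        rw [← pow_succ', Nat.sub_add_cancel (Finset.mem_Icc.1 hv).1]
    have h6 := mul_neg_geom_sum q N
    rw [h5, le_div_iff₀ (by linarith), mul_assoc, mul_comm _ (1 - q), h6]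
    have : 0 ≤ q ^ N := by positivity
    nlinarith
  refine h4.trans (le_of_eq ?_)
  have h7 : 1 - q = x / (N + x) := by rw [hq]; field_simp; ring
  rw [h7, hq, div_div_div_cancel_right₀ (by positivity)]

/-- Sets of pairwise different sizes inside `E` can be hit by few elements. -/
lemma exists_transversal {α : Type*} [DecidableEq α] (E : Finset α)
    (F : Finset (Finset α)) (hF : ∀ Z ∈ F, Z ⊆ E) (hne : ∀ Z ∈ F, Z.Nonempty)
    (hinj : ∀ Z ∈ F, ∀ Z' ∈ F, Z.card = Z'.card → Z = Z') :
    ∃ X ⊆ E, (X.card : ℝ) ≤ 2 * Real.sqrt E.card + 1 ∧ ∀ Z ∈ F, ¬ Disjoint Z X := by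
  rcases E.eq_empty_or_nonempty with rfl | hE
  · refine ⟨∅, by simp, by simp, fun Z hZ => ?_⟩
    have := hF Z hZ
    have h2 := hne Z hZ
    rw [Finset.subset_empty.1 this] at h2
    simp at h2
  set N := E.card with hN
  have hN0 : 0 < N := hE.card_pos
  have hNr : (0 : ℝ) < N := by exact_mod_cast hN0
  have hsq : 0 < Real.sqrt N := Real.sqrt_pos.2 hNr
  set x := ⌈Real.sqrt N⌉₊ with hx
  have hx0 : 0 < x := Nat.ceil_pos.2 hsq
  obtain ⟨X, hXE, hXc, hX⟩ := exists_hitting_set E hE x F hF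
  have hsum : ∑ Z ∈ F, (1 - (Z.card : ℝ) / E.card) ^ x ≤ N / x := by
    refine le_trans ?_ (sum_one_sub_div_pow_le N x hN0 hx0)
    rw [← Finset.sum_image (s := F) (g := Finset.card)
      (f := fun s : ℕ => (1 - (s : ℝ) / N) ^ x) hinj]
    refine Finset.sum_le_sum_of_subset_of_nonneg ?_ ?_
    · intro s hs
      obtain ⟨Z, hZ, rfl⟩ := Finset.mem_image.1 hs
      exact Finset.mem_Icc.2 ⟨(hne Z hZ).card_pos, Finset.card_le_card (hF Z hZ)⟩
    · intro s hs _
      have : (s : ℝ) ≤ N := by exact_mod_cast (Finset.mem_Icc.1 hs).2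
      have : 0 ≤ 1 - (s : ℝ) / N := by rw [sub_nonneg, div_le_one hNr]; exact this
      positivity
  set B := F.filter fun Z => Disjoint Z X with hB
  have : Nonempty α := ⟨hE.choose⟩
  choose! f hf using hne
  refine ⟨X ∪ B.image f, ?_, ?_, ?_⟩
  · refine Finset.union_subset hXE ?_
    intro a ha
    obtain ⟨Z, hZ, rfl⟩ := Finset.mem_image.1 ha
    have hZF := (Finset.mem_filter.1 hZ).1
    exact hF Z hZF (hf Z hZF)
  · have h1 : ((X ∪ B.image f).card : ℝ) ≤ X.card + B.card := by
      exact_mod_cast (Finset.card_union_le _ _).trans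
        (Nat.add_le_add_left Finset.card_image_le _)
    have h2 : (X.card : ℝ) ≤ x := by exact_mod_cast hXc
    have h3 : (x : ℝ) ≤ Real.sqrt N + 1 := (Nat.ceil_lt_add_one hsq.le).le
    have h4 : Real.sqrt N ≤ x := Nat.le_ceil _
    have h5 : (N : ℝ) / x ≤ Real.sqrt N := by
      rw [div_le_iff₀ (by exact_mod_cast hx0)]
      calc (N : ℝ) = Real.sqrt N * Real.sqrt N := (Real.mul_self_sqrt hNr.le).symm
        _ ≤ _ := mul_le_mul_of_nonneg_left h4 hsq.le
    linarith [hX.trans hsum]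
  · intro Z hZ hd
    rw [Finset.disjoint_union_right] at hd
    have hZB : Z ∈ B := Finset.mem_filter.2 ⟨hZ, hd.1⟩
    exact Finset.disjoint_left.1 hd.2 (hf Z hZ) (Finset.mem_image_of_mem f hZB)

/-- Erdős–Turán window counting for points of `[0, L)` almost all of whose differences are
distinct up to an additive error `W`. -/
lemma card_le_of_distinct_differences {ι : Type*} [DecidableEq ι] (I : Finset ι) (t : ι → ℕ)
    (L u W : ℕ) (ht : ∀ i ∈ I, t i < L) (Bad : Finset (ι × ι)) (c : ι → ι → ℕ)
    (hc : ∀ i ∈ I, ∀ j ∈ I, i ≠ j → (i, j) ∉ Bad →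
      1 ≤ c i j ∧ c i j + t i ≤ t j + W + 2 * (t i - t j) )
    (hinj : ∀ i ∈ I, ∀ j ∈ I, i ≠ j → (i, j) ∉ Bad →
      ∀ i' ∈ I, ∀ j' ∈ I, i' ≠ j' → (i', j') ∉ Bad → c i j = c i' j' →
      (i' = i ∧ j' = j) ∨ (i' = j ∧ j' = i)) :
    (I.card * u) ^ 2 ≤ (L + u) * (I.card * u + Bad.card * u + (u + W) ^ 2) := by
  classical
  set A : ℕ → Finset ι := fun τ => I.filter fun i => t i ≤ τ ∧ τ < t i + u with hA
  have h1 : ∑ τ ∈ Finset.range (L + u), (A τ).card = I.card * u := by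
    simp_rw [hA, Finset.card_filter]
    rw [Finset.sum_comm, Finset.sum_const_nat (m := u)]
    intro i hi
    rw [← Finset.card_filter]
    have : (Finset.range (L + u)).filter (fun τ => t i ≤ τ ∧ τ < t i + u)
        = Finset.Ico (t i) (t i + u) := by
      ext τ
      have := ht i hi
      simp only [Finset.mem_filter, Finset.mem_range, Finset.mem_Ico]
      omega
    rw [this]; simp
  have h2 : (I.card * u) ^ 2 ≤ (L + u) * ∑ τ ∈ Finset.range (L + u), (A τ).card ^ 2 := by
    rw [← h1]
    have := sq_sum_le_card_mul_sum_sq (s := Finset.range (L + u)) (f := fun τ => (A τ).card)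
    simpa using this
  set w : ι × ι → ℕ := fun p =>
    ((Finset.range (L + u)).filter fun τ => p.1 ∈ A τ ∧ p.2 ∈ A τ).card with hw
  have h3 : ∑ τ ∈ Finset.range (L + u), (A τ).card ^ 2 = ∑ p ∈ I ×ˢ I, w p := by
    simp_rw [hw, Finset.card_filter]
    rw [Finset.sum_comm]
    refine Finset.sum_congr rfl fun τ _ => ?_
    rw [sq, ← Finset.card_product, ← Finset.card_filter]
    congr 1
    ext p
    simp only [hA, Finset.mem_product, Finset.mem_filter]
    tauto
  have hwle : ∀ p : ι × ι, w p ≤ u - (max (t p.1) (t p.2) - min (t p.1) (t p.2)) := by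
    intro p
    have : ((Finset.range (L + u)).filter fun τ => p.1 ∈ A τ ∧ p.2 ∈ A τ) ⊆
        Finset.Ico (max (t p.1) (t p.2)) (min (t p.1) (t p.2) + u) := by
      intro τ
      simp only [hA, Finset.mem_filter, Finset.mem_range, Finset.mem_Ico]
      omega
    refine (Finset.card_le_card this).trans ?_
    rw [Nat.card_Ico]
    omega
  have hwu : ∀ p : ι × ι, w p ≤ u := fun p => (hwle p).trans (Nat.sub_le _ _)
  set Good := (I ×ˢ I).filter fun p => p.1 ≠ p.2 ∧ p ∉ Bad with hGood
  have h4 : ∑ p ∈ I ×ˢ I, w p ≤ I.card * u + Bad.card * u + ∑ p ∈ Good, w p := by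
    have hsub : I ×ˢ I ⊆ (I.image fun i => (i, i)) ∪ Bad ∪ Good := by
      intro p hp
      by_cases h : p.1 = p.2
      · refine Finset.mem_union_left _ (Finset.mem_union_left _ (Finset.mem_image.2
          ⟨p.1, (Finset.mem_product.1 hp).1, ?_⟩))
        ext <;> simp [h]
      · by_cases h' : p ∈ Bad
        · exact Finset.mem_union_left _ (Finset.mem_union_right _ h')
        · exact Finset.mem_union_right _ (Finset.mem_filter.2 ⟨hp, h, h'⟩)
    have hun : ∀ S T : Finset (ι × ι), ∑ p ∈ S ∪ T, w p ≤ ∑ p ∈ S, w p + ∑ p ∈ T, w p := by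
      intro S T
      rw [← Finset.sum_union_inter]
      exact Nat.le_add_right _ _
    have hcst : ∀ S : Finset (ι × ι), ∑ p ∈ S, w p ≤ S.card * u := by
      intro S
      simpa using Finset.sum_le_card_nsmul S w u (fun p _ => hwu p)
    have := Finset.sum_le_sum_of_subset (f := w) hsub
    have e1 := hun ((I.image fun i => (i, i)) ∪ Bad) Good
    have e2 := hun (I.image fun i => (i, i)) Bad
    have e3 := (hcst (I.image fun i => (i, i))).trans
      (Nat.mul_le_mul_right u Finset.card_image_le)
    have e4 := hcst Bad
    omega
  have h5 : ∑ p ∈ Good, w p ≤ (u + W) ^ 2 := by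
    have e1 : ∑ p ∈ Good, w p ≤ ∑ p ∈ Good, (u + W - c p.1 p.2) := by
      refine Finset.sum_le_sum fun p hp => (hwle p).trans ?_
      obtain ⟨hp1, hp2, hp3⟩ := Finset.mem_filter.1 hp
      have := (hc p.1 (Finset.mem_product.1 hp1).1 p.2 (Finset.mem_product.1 hp1).2 hp2 hp3).2
      omega
    refine e1.trans ?_
    rw [← Finset.sum_fiberwise_of_maps_to (t := Good.image fun p => c p.1 p.2)
      (fun p hp => Finset.mem_image_of_mem (fun p : ι × ι => c p.1 p.2) hp)]
    have e2 : ∀ v ∈ Good.image (fun p => c p.1 p.2),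
        ∑ p ∈ Good with c p.1 p.2 = v, (u + W - c p.1 p.2) ≤ 2 * (u + W - v) := by
      intro v hv
      obtain ⟨q, hq, rfl⟩ := Finset.mem_image.1 hv
      obtain ⟨hq1, hq2, hq3⟩ := Finset.mem_filter.1 hq
      rw [Finset.sum_congr rfl (g := fun _ => u + W - c q.1 q.2)
        (fun p hp => by rw [(Finset.mem_filter.1 hp).2]), Finset.sum_const, smul_eq_mul]
      refine Nat.mul_le_mul_right _ ?_
      refine le_trans (Finset.card_le_card (t := {q, (q.2, q.1)}) ?_) Finset.card_le_two
      intro p hp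
      obtain ⟨hp0, hpe⟩ := Finset.mem_filter.1 hp
      obtain ⟨hp1, hp2, hp3⟩ := Finset.mem_filter.1 hp0
      have := hinj q.1 (Finset.mem_product.1 hq1).1 q.2 (Finset.mem_product.1 hq1).2 hq2 hq3
        p.1 (Finset.mem_product.1 hp1).1 p.2 (Finset.mem_product.1 hp1).2 hp2 hp3 hpe.symm
      simp only [Finset.mem_insert, Finset.mem_singleton, Prod.ext_iff]
      exact this
    refine (Finset.sum_le_sum e2).trans ?_
    rw [← Finset.mul_sum]
    have e3 : ∑ v ∈ Good.image (fun p => c p.1 p.2), (u + W - v) ≤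
        ∑ v ∈ Finset.Icc 1 (u + W), (u + W - v) := by
      rw [← Finset.sum_filter_add_sum_filter_not _ (fun v => v ≤ u + W)]
      rw [Finset.sum_eq_zero (s := Finset.filter (fun v => ¬ v ≤ u + W) _), add_zero]
      · refine Finset.sum_le_sum_of_subset ?_
        intro v hv
        obtain ⟨hv1, hv2⟩ := Finset.mem_filter.1 hv
        obtain ⟨q, hq, rfl⟩ := Finset.mem_image.1 hv1
        obtain ⟨hq1, hq2, hq3⟩ := Finset.mem_filter.1 hq
        exact Finset.mem_Icc.2 ⟨(hc q.1 (Finset.mem_product.1 hq1).1 q.2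
          (Finset.mem_product.1 hq1).2 hq2 hq3).1, hv2⟩
      · intro v hv
        have := (Finset.mem_filter.1 hv).2
        omega
    have e4 : ∀ m : ℕ, 2 * ∑ v ∈ Finset.Icc 1 m, (m - v) ≤ m ^ 2 := by
      intro m
      have : ∑ v ∈ Finset.Icc 1 m, (m - v) = ∑ v ∈ Finset.range m, v := by
        rw [← Finset.sum_range_reflect]
        rw [Finset.range_eq_Ico, Finset.sum_Ico_eq_sum_range]
        refine Finset.sum_bij' (fun v _ => v - 1) (fun v _ => v + 1) ?_ ?_ ?_ ?_ ?_ <;>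
          simp <;> intros <;> omega
      rw [this, mul_comm, Finset.sum_range_id_mul_two, sq]
      exact Nat.mul_le_mul_left _ (Nat.sub_le _ _)
    exact (Nat.mul_le_mul_left 2 e3).trans (e4 _)
  refine h2.trans (Nat.mul_le_mul_left _ ?_)
  rw [h3]
  omega

open SimpleGraph

section Paths

variable {V : Type*} {G : SimpleGraph V}

/-- There is a path from `a` to `b` with support `S`, edge set `E` and length `m`. -/
def HasPath (G : SimpleGraph V) (a b : V) (S : Set V) (E : Set (Sym2 V)) (m : ℕ) : Prop :=
  ∃ p : G.Walk a b, p.IsPath ∧ {v | v ∈ p.support} = S ∧ {e | e ∈ p.edges} = E ∧ p.length = m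

/-- There is a cycle with edge set `Z` and length `m`. -/
def HasCycle (G : SimpleGraph V) (Z : Set (Sym2 V)) (m : ℕ) : Prop :=
  ∃ (u : V) (p : G.Walk u u), p.IsCycle ∧ {e | e ∈ p.edges} = Z ∧ p.length = m

namespace HasPath

variable {a b d : V} {S S' : Set V} {E E' : Set (Sym2 V)} {m m' : ℕ}

lemma symm (h : HasPath G a b S E m) : HasPath G b a S E m := by
  obtain ⟨p, hp, rfl, rfl, rfl⟩ := h
  exact ⟨p.reverse, hp.reverse, by simp, by simp, by simp⟩

lemma append (h : HasPath G a b S E m) (h' : HasPath G b d S' E' m')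
    (hS : ∀ v ∈ S, v ∈ S' → v = b) : HasPath G a d (S ∪ S') (E ∪ E') (m + m') := by
  obtain ⟨p, hp, rfl, rfl, rfl⟩ := h
  obtain ⟨q, hq, rfl, rfl, rfl⟩ := h'
  refine ⟨p.append q, ?_, ?_, ?_, by simp⟩
  · refine Walk.IsPath.mk' ?_
    rw [Walk.support_append, List.nodup_append']
    refine ⟨hp.support_nodup, hq.support_nodup.tail, ?_⟩
    intro v hv hv'
    have h1 := hS v hv (List.mem_of_mem_tail hv')
    have h2 := hq.support_nodup
    rw [← Walk.cons_tail_support, List.nodup_cons] at h2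
    exact h2.1 (h1 ▸ hv')
  · ext v
    simp [Walk.mem_support_append_iff]
  · ext e
    simp

lemma cycle (h : HasPath G a b S E m) (h' : HasPath G b a S' E' m')
    (hS : ∀ v ∈ S, v ∈ S' → v = a ∨ v = b) (hm : 3 ≤ m + m') :
    HasCycle G (E ∪ E') (m + m') := by
  obtain ⟨p, hp, rfl, rfl, rfl⟩ := h
  obtain ⟨q, hq, rfl, rfl, rfl⟩ := h'
  refine ⟨a, p.append q, ?_, by ext; simp, by simp⟩
  refine hp.isCycle_append hq ?_ (by omega)
  intro v hv hv'
  have h2 := hq.support_nodup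
  rw [← Walk.cons_tail_support, List.nodup_cons] at h2
  have h1 := hp.support_nodup
  rw [← Walk.cons_tail_support, List.nodup_cons] at h1
  rcases hS v (List.mem_of_mem_tail hv) (List.mem_of_mem_tail hv') with rfl | rfl
  · exact h1.1 hv
  · exact h2.1 hv'

lemma length_pos (h : HasPath G a b S E m) (hab : a ≠ b) : 1 ≤ m := by
  obtain ⟨p, hp, rfl, rfl, rfl⟩ := h
  rcases p with _ | _
  · exact absurd rfl hab
  · simp

lemma eq_of_length_one (h : HasPath G a b S E 1) : E = {s(a, b)} := by
  obtain ⟨p, hp, rfl, rfl, hl⟩ := h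
  rcases p with _ | ⟨_, p⟩
  · simp at hl
  · rcases p with _ | _
    · ext; simp
    · simp at hl

end HasPath

lemma HasCycle.length_le [Fintype V] {Z : Set (Sym2 V)} {m : ℕ} (h : HasCycle G Z m) :
    m ≤ Fintype.card V := by
  obtain ⟨u, p, hp, rfl, rfl⟩ := h
  have h1 := hp.isPath_tail.length_lt
  have h2 := hp.three_le_length
  rw [Walk.length_tail] at h1
  omega

/-- The closed walk `c 0, c 1, …, c L = c 0` is a cycle, continued periodically. -/
structure CyclicParam (G : SimpleGraph V) (c : ℕ → V) (L : ℕ) : Prop where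
  three_le : 3 ≤ L
  adj : ∀ t, G.Adj (c t) (c (t + 1))
  per : ∀ t, c (t + L) = c t
  inj : ∀ s < L, ∀ t < L, c s = c t → s = t

/-- The edges of a parametrised cycle. -/
def cycleEdges (c : ℕ → V) : Set (Sym2 V) := {e | ∃ t, e = s(c t, c (t + 1))}

namespace CyclicParam

variable {c : ℕ → V} {L : ℕ}

lemma mod (hc : CyclicParam G c L) (t : ℕ) : c (t % L) = c t := by
  have h : ∀ k s, c (s + L * k) = c s := by
    intro k
    induction k with
    | zero => simp
    | succ k ih => intro s; rw [Nat.mul_succ, ← add_assoc, hc.per, ih]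
  conv_rhs => rw [← Nat.mod_add_div t L]
  exact (h _ _).symm

lemma eq_of_eq (hc : CyclicParam G c L) {s t : ℕ} (h : c s = c t) (h1 : s < t + L)
    (h2 : t < s + L) : s = t := by
  have hL := hc.three_le
  rw [← hc.mod s, ← hc.mod t] at h
  have h3 := hc.inj _ (Nat.mod_lt _ (by omega)) _ (Nat.mod_lt _ (by omega)) h
  have e1 := Nat.mod_add_div s L
  have e2 := Nat.mod_add_div t L
  rcases lt_trichotomy (s / L) (t / L) with h4 | h4 | h4
  · have := Nat.mul_le_mul_left L (Nat.succ_le_of_lt h4)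
    rw [Nat.mul_succ] at this
    omega
  · rw [h4] at e1; omega
  · have := Nat.mul_le_mul_left L (Nat.succ_le_of_lt h4)
    rw [Nat.mul_succ] at this
    omega

lemma arc (hc : CyclicParam G c L) {i j : ℕ} (hij : i ≤ j) (hj : j < i + L) :
    HasPath G (c i) (c j) {v | ∃ t, i ≤ t ∧ t ≤ j ∧ v = c t}
      {e | ∃ t, i ≤ t ∧ t < j ∧ e = s(c t, c (t + 1))} (j - i) := by
  induction j, hij using Nat.le_induction with
  | base =>
    refine ⟨Walk.nil, Walk.IsPath.nil, ?_, ?_, by simp⟩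
    · ext v
      simp only [Walk.support_nil, List.mem_singleton, Set.mem_ofPred_eq]
      constructor
      · rintro rfl
        exact ⟨i, le_rfl, le_rfl, rfl⟩
      · rintro ⟨t, h1, h2, rfl⟩
        rw [le_antisymm h2 h1]
    · ext e
      simp only [Walk.edges_nil, List.not_mem_nil, Set.mem_ofPred_eq, false_iff]
      rintro ⟨t, h1, h2, -⟩
      omega
  | succ j hij ih =>
    have h1 := ih (by omega)
    have h2 : HasPath G (c j) (c (j + 1)) {c j, c (j + 1)} {s(c j, c (j + 1))} 1 := by
      refine ⟨(hc.adj j).toWalk, (hc.adj j).isPath_toWalk, ?_, ?_, by simp⟩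
      · ext v; simp
      · ext v; simp
    have h3 := h1.append h2 (by
      rintro v ⟨t, ht1, ht2, rfl⟩ hv
      rcases hv with hv | hv
      · exact hv
      · have := hc.eq_of_eq hv (by omega) (by omega)
        omega)
    convert h3 using 1
    · ext v
      constructor
      · rintro ⟨t, ht1, ht2, rfl⟩
        rcases Nat.lt_or_ge j t with h | h
        · right; right; rw [show t = j + 1 by omega]; rfl
        · left; exact ⟨t, ht1, h, rfl⟩
      · rintro (⟨t, ht1, ht2, rfl⟩ | rfl | rfl)
        · exact ⟨t, ht1, by omega, rfl⟩
        · exact ⟨j, hij, by omega, rfl⟩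
        · exact ⟨j + 1, by omega, le_rfl, rfl⟩
    · ext v
      constructor
      · rintro ⟨t, ht1, ht2, rfl⟩
        rcases Nat.lt_or_ge t j with h | h
        · left; exact ⟨t, ht1, h, rfl⟩
        · right; rw [show t = j by omega]; rfl
      · rintro (⟨t, ht1, ht2, rfl⟩ | rfl)
        · exact ⟨t, ht1, by omega, rfl⟩
        · exact ⟨j, hij, by omega, rfl⟩
    · omega

/-- Any two points of an interval shorter than the cycle are joined inside that interval. -/
lemma exists_arc (hc : CyclicParam G c L) {q r lo hi : ℕ} (hq : lo < q ∧ q < hi)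
    (hr : lo < r ∧ r < hi) (h : hi ≤ lo + L) :
    ∃ S E m, HasPath G (c q) (c r) S E m ∧ (∀ v ∈ S, ∃ t, lo < t ∧ t < hi ∧ v = c t) ∧
      E ⊆ cycleEdges c := by
  rcases le_total q r with hqr | hqr
  · refine ⟨_, _, _, hc.arc hqr (by omega), ?_, ?_⟩
    · rintro v ⟨t, h1, h2, rfl⟩
      exact ⟨t, by omega, by omega, rfl⟩
    · rintro v ⟨t, h1, h2, rfl⟩
      exact ⟨t, rfl⟩
  · refine ⟨_, _, _, (hc.arc hqr (by omega)).symm, ?_, ?_⟩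
    · rintro v ⟨t, h1, h2, rfl⟩
      exact ⟨t, by omega, by omega, rfl⟩
    · rintro v ⟨t, h1, h2, rfl⟩
      exact ⟨t, rfl⟩

end CyclicParam

/-- A path from `a` to `b` meeting the cycle `c` in its ends only and edge-disjoint from `c`. -/
structure HasEar (G : SimpleGraph V) (c : ℕ → V) (a b : V) (S : Set V) (E : Set (Sym2 V))
    (m : ℕ) : Prop where
  path : HasPath G a b S E m
  ends : ∀ t, c t ∈ S → c t = a ∨ c t = b
  edge : ∀ e ∈ E, e ∉ cycleEdges c

namespace HasEar

variable {c : ℕ → V} {L : ℕ} {a b : V} {S S' S₁ S₂ : Set V} {E E' E₁ E₂ : Set (Sym2 V)}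
  {m m' m₁ m₂ : ℕ}

lemma symm (h : HasEar G c a b S E m) : HasEar G c b a S E m :=
  ⟨h.path.symm, fun t ht => (h.ends t ht).symm, h.edge⟩

/-- An ear and an arc with the same ends form a cycle. -/
lemma cycle_arc (hc : CyclicParam G c L) {i j : ℕ} (hij : i < j) (hj : j < i + L)
    (h : HasEar G c (c i) (c j) S E m) :
    ∃ k, HasCycle G ({e | ∃ t, i ≤ t ∧ t < j ∧ e = s(c t, c (t + 1))} ∪ E) k := by
  have hne : c i ≠ c j := fun h => by have := hc.eq_of_eq h (by omega) (by omega); omega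
  refine ⟨_, (hc.arc hij.le hj).cycle h.path.symm ?_ ?_⟩
  · rintro v ⟨t, ht1, ht2, rfl⟩ hv
    exact h.ends t hv
  · have h1 := h.path.length_pos hne
    by_contra h2
    have h3 : m = 1 := by omega
    have h4 : j = i + 1 := by omega
    subst h3 h4
    have := h.path.eq_of_length_one
    exact h.edge s(c i, c (i + 1)) (by rw [this]; rfl) ⟨i, rfl⟩

/-- Two nested ears form a cycle with the two arcs between their ends. -/
lemma cycle_nested (hc : CyclicParam G c L) {i j k l : ℕ} (hik : i ≤ k) (hkl : k < l)
    (hlj : l ≤ j) (hj : j < i + L) (hne : i < k ∨ l < j)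
    (h : HasEar G c (c i) (c j) S E m) (h' : HasEar G c (c k) (c l) S' E' m')
    (hd : ∀ v ∈ S, v ∈ S' → ∃ t, v = c t) :
    ∃ Z, HasCycle G Z ((k - i) + (j - l) + m + m') ∧ Z \ cycleEdges c = E ∪ E' := by
  have hne1 : c i ≠ c j := fun h => by have := hc.eq_of_eq h (by omega) (by omega); omega
  have hne2 : c k ≠ c l := fun h => by have := hc.eq_of_eq h (by omega) (by omega); omega
  have p1 := (hc.arc hik (by omega)).append h'.path (by
    rintro v ⟨t, ht1, ht2, rfl⟩ hv
    rcases h'.ends t hv with h | h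
    · exact h
    · have := hc.eq_of_eq h (by omega) (by omega)
      omega)
  have p2 := p1.append (hc.arc hlj (by omega)) (by
    rintro v (⟨t, ht1, ht2, rfl⟩ | hv) ⟨t', ht1', ht2', ht'⟩
    · have := hc.eq_of_eq ht' (by omega) (by omega)
      omega
    · subst ht'
      rcases h'.ends t' hv with h | h
      · have := hc.eq_of_eq h (by omega) (by omega)
        omega
      · exact h)
  have l1 := h.path.length_pos hne1
  have l2 := h'.path.length_pos hne2
  have p3 := p2.cycle h.path.symm (by
    rintro v ((⟨t, ht1, ht2, rfl⟩ | hv) | ⟨t, ht1, ht2, rfl⟩) hv'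
    · exact h.ends t hv'
    · obtain ⟨t, rfl⟩ := hd v hv' hv
      exact h.ends t hv'
    · exact h.ends t hv') (by omega)
  refine ⟨_, (by convert p3 using 1; omega), ?_⟩
  ext e
  constructor
  · rintro ⟨((⟨t, -, -, rfl⟩ | he) | ⟨t, -, -, rfl⟩) | he, he'⟩
    · exact absurd ⟨t, rfl⟩ he'
    · exact Or.inr he
    · exact absurd ⟨t, rfl⟩ he'
    · exact Or.inl he
  · rintro (he | he)
    · exact ⟨Or.inr he, h.edge e he⟩
    · exact ⟨Or.inl (Or.inl (Or.inr he)), h'.edge e he⟩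

/-- An ear from `c b` back to `c a` together with two ears leaving and re-entering the arc
from `c a` to `c b`, whose other ends are joined off the arcs used. -/
lemma cycle_three (hc : CyclicParam G c L) {a b p q r s lo hi : ℕ} (hap : a ≤ p) (hps : p < s)
    (hsb : s ≤ b) (hb : b < a + L) (hlo : (p ≤ lo ∧ hi ≤ s) ∨ (b ≤ lo ∧ hi ≤ a + L))
    (hq : lo < q ∧ q < hi) (hr : lo < r ∧ r < hi)
    (h : HasEar G c (c a) (c b) S E m) (h₁ : HasEar G c (c p) (c q) S₁ E₁ m₁)
    (h₂ : HasEar G c (c r) (c s) S₂ E₂ m₂)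
    (hd₁ : ∀ v ∈ S, v ∈ S₁ → ∃ t, v = c t) (hd₂ : ∀ v ∈ S, v ∈ S₂ → ∃ t, v = c t)
    (hd₁₂ : ∀ v ∈ S₁, v ∈ S₂ → ∃ t, v = c t) :
    ∃ k Z, HasCycle G Z k ∧ Z \ cycleEdges c = E ∪ E₁ ∪ E₂ := by
  have key : ∀ {x y : ℕ}, c x = c y → x < y + L → y < x + L → x = y := hc.eq_of_eq
  have hneab : c a ≠ c b := fun h => by have := key h (by omega) (by omega); omega
  have hne1 : c p ≠ c q := fun h => by have := key h (by omega) (by omega); omega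
  have hne2 : c r ≠ c s := fun h => by have := key h (by omega) (by omega); omega
  obtain ⟨S₀, E₀, m₀, p₀, hS₀, hE₀⟩ := hc.exists_arc hq hr (by omega)
  have p1 := (hc.arc hap (by omega)).append h₁.path (by
    rintro v ⟨t, ht1, ht2, rfl⟩ hv
    rcases h₁.ends t hv with h | h
    · exact h
    · have := key h (by omega) (by omega)
      omega)
  have p2 := p1.append p₀ (by
    rintro v (⟨t, ht1, ht2, rfl⟩ | hv) hv'
    · obtain ⟨t', ht1', ht2', ht'⟩ := hS₀ _ hv'
      have := key ht' (by omega) (by omega)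
      omega
    · obtain ⟨t', ht1', ht2', rfl⟩ := hS₀ _ hv'
      rcases h₁.ends t' hv with h | h
      · have := key h (by omega) (by omega)
        omega
      · exact h)
  have p3 := p2.append h₂.path (by
    rintro v ((⟨t, ht1, ht2, rfl⟩ | hv) | hv) hv'
    · rcases h₂.ends t hv' with h | h
      · have := key h (by omega) (by omega)
        omega
      · have := key h (by omega) (by omega)
        omega
    · obtain ⟨t, rfl⟩ := hd₁₂ v hv hv'
      rcases h₂.ends t hv' with h | h
      · exact h
      · rcases h₁.ends t hv with h' | h'
        · have := key (h'.symm.trans h) (by omega) (by omega)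
          omega
        · have := key (h'.symm.trans h) (by omega) (by omega)
          omega
    · obtain ⟨t', ht1', ht2', rfl⟩ := hS₀ _ hv
      rcases h₂.ends t' hv' with h | h
      · exact h
      · have := key h (by omega) (by omega)
        omega)
  have p4 := p3.append (hc.arc hsb (by omega)) (by
    rintro v (((⟨t, ht1, ht2, rfl⟩ | hv) | hv) | hv) ⟨t', ht1', ht2', ht'⟩
    · have := key ht' (by omega) (by omega)
      omega
    · subst ht'
      rcases h₁.ends t' hv with h | h
      · have := key h (by omega) (by omega)
        omega
      · have := key h (by omega) (by omega)
        omega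
    · obtain ⟨t, ht1, ht2, rfl⟩ := hS₀ _ hv
      have := key ht' (by omega) (by omega)
      omega
    · subst ht'
      rcases h₂.ends t' hv with h | h
      · have := key h (by omega) (by omega)
        omega
      · exact h)
  have l1 := h.path.length_pos hneab
  have l2 := h₁.path.length_pos hne1
  have l3 := h₂.path.length_pos hne2
  have p5 := p4.cycle h.path.symm (by
    rintro v ((((⟨t, ht1, ht2, rfl⟩ | hv) | hv) | hv) | ⟨t, ht1, ht2, rfl⟩) hv'
    · exact h.ends t hv'
    · obtain ⟨t, rfl⟩ := hd₁ v hv' hv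
      exact h.ends t hv'
    · obtain ⟨t, ht1, ht2, rfl⟩ := hS₀ _ hv
      exact h.ends t hv'
    · obtain ⟨t, rfl⟩ := hd₂ v hv' hv
      exact h.ends t hv'
    · exact h.ends t hv') (by omega)
  refine ⟨_, _, p5, ?_⟩
  ext e
  constructor
  · rintro ⟨((((⟨t, -, -, rfl⟩ | he) | he) | he) | ⟨t, -, -, rfl⟩) | he, he'⟩
    · exact absurd ⟨t, rfl⟩ he'
    · exact Or.inl (Or.inr he)
    · exact absurd (hE₀ he) he'
    · exact Or.inr he
    · exact absurd ⟨t, rfl⟩ he'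
    · exact Or.inl (Or.inl he)
  · rintro ((he | he) | he)
    · exact ⟨Or.inr he, h.edge e he⟩
    · exact ⟨Or.inl (Or.inl (Or.inl (Or.inl (Or.inr he)))), h₁.edge e he⟩
    · exact ⟨Or.inl (Or.inl (Or.inr he)), h₂.edge e he⟩

/-- Two crossing ears lie on a common cycle. -/
lemma cycle_cross (hc : CyclicParam G c L) {x y A B : ℕ} (hxA : x < A) (hAy : A < y)
    (hyB : y < B) (hB : B < x + L)
    (h : HasEar G c (c x) (c y) S E m) (h' : HasEar G c (c A) (c B) S' E' m')
    (hd : ∀ v ∈ S, v ∈ S' → ∃ t, v = c t) :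
    ∃ k Z, HasCycle G Z k ∧ Z \ cycleEdges c = E ∪ E' := by
  have key : ∀ {x y : ℕ}, c x = c y → x < y + L → y < x + L → x = y := hc.eq_of_eq
  have hne1 : c x ≠ c y := fun h => by have := key h (by omega) (by omega); omega
  have hne2 : c A ≠ c B := fun h => by have := key h (by omega) (by omega); omega
  have p1 := (hc.arc hxA.le (by omega)).append h'.path (by
    rintro v ⟨t, ht1, ht2, rfl⟩ hv
    rcases h'.ends t hv with h | h
    · exact h
    · have := key h (by omega) (by omega)
      omega)
  have p2 := p1.append (hc.arc hyB.le (by omega)).symm (by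
    rintro v (⟨t, ht1, ht2, rfl⟩ | hv) ⟨t', ht1', ht2', ht'⟩
    · have := key ht' (by omega) (by omega)
      omega
    · subst ht'
      rcases h'.ends t' hv with h | h
      · have := key h (by omega) (by omega)
        omega
      · exact h)
  have l1 := h.path.length_pos hne1
  have l2 := h'.path.length_pos hne2
  have p3 := p2.cycle h.path.symm (by
    rintro v ((⟨t, ht1, ht2, rfl⟩ | hv) | ⟨t, ht1, ht2, rfl⟩) hv'
    · exact h.ends t hv'
    · obtain ⟨t, rfl⟩ := hd v hv' hv
      exact h.ends t hv'
    · exact h.ends t hv') (by omega)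
  refine ⟨_, _, p3, ?_⟩
  ext e
  constructor
  · rintro ⟨((⟨t, -, -, rfl⟩ | he) | ⟨t, -, -, rfl⟩) | he, he'⟩
    · exact absurd ⟨t, rfl⟩ he'
    · exact Or.inr he
    · exact absurd ⟨t, rfl⟩ he'
    · exact Or.inl he
  · rintro (he | he)
    · exact ⟨Or.inr he, h.edge e he⟩
    · exact ⟨Or.inl (Or.inl (Or.inr he)), h'.edge e he⟩

end HasEar

end Paths

lemma NoRepeatedCycleLengths.eq {V : Type*} {G : SimpleGraph V} (h : NoRepeatedCycleLengths G)
    {Z Z' : Set (Sym2 V)} {m : ℕ} (h1 : HasCycle G Z m) (h2 : HasCycle G Z' m) : Z = Z' := by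
  obtain ⟨u, p, hp, rfl, rfl⟩ := h1
  obtain ⟨u', p', hp', rfl, hl⟩ := h2
  exact h _ _ _ _ hp hp' hl.symm

/-- A family of ears of the parametrised cycle `c`, sorted into classes. Ears of different classes
are disjoint off the cycle, and the edges of an ear occur in a union of ears of different
classes only if the ear is one of them. -/
structure EarSystem {V : Type*} (G : SimpleGraph V) (c : ℕ → V) (L : ℕ) (ι κ : Type*) where
  x : ι → ℕ
  y : ι → ℕ
  S : ι → Set V
  E : ι → Set (Sym2 V)
  w : ι → ℕ
  cls : ι → κ
  x_lt : ∀ i, x i < y i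
  y_lt : ∀ i, y i < L
  ear : ∀ i, HasEar G c (c (x i)) (c (y i)) (S i) (E i) (w i)
  compat : ∀ i j, cls i ≠ cls j → ∀ v ∈ S i, v ∈ S j → ∃ t, v = c t
  ident : ∀ (T : Set ι) (i : ι), Set.InjOn cls T → E i ⊆ ⋃ j ∈ T, E j → i ∈ T
  inj : ∀ i j, x i = x j → y i = y j → i = j

namespace EarSystem

variable {V : Type*} {G : SimpleGraph V} {c : ℕ → V} {L : ℕ} {ι κ : Type*}

/-- The ends of `f` separate the ends of `e` on the cycle. -/
def Crosses (D : EarSystem G c L ι κ) (e f : ι) : Prop :=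
  (D.x e < D.x f ∧ D.x f < D.y e ∧ D.y e < D.y f) ∨
    (D.x f < D.x e ∧ D.x e < D.y f ∧ D.y f < D.y e)

open Classical in
/-- Lower end of the interval spanned by `f` that contains, or is contained in, that of `e`. -/
noncomputable def lo (D : EarSystem G c L ι κ) (e f : ι) : ℕ :=
  if (D.x e ≤ D.x f ∧ D.y f ≤ D.y e) ∨ (D.x f ≤ D.x e ∧ D.y e ≤ D.y f) then D.x f + L
  else if D.y f ≤ D.x e then D.y f + L else D.y f

open Classical in
/-- Upper end of the interval spanned by `f` that contains, or is contained in, that of `e`. -/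
noncomputable def hi (D : EarSystem G c L ι κ) (e f : ι) : ℕ :=
  if (D.x e ≤ D.x f ∧ D.y f ≤ D.y e) ∨ (D.x f ≤ D.x e ∧ D.y e ≤ D.y f) then D.y f + L
  else if D.y f ≤ D.x e then D.x f + L + L else D.x f + L

/-- The three ears lie on a cycle whose remaining edges are on the base cycle. -/
def Tri (D : EarSystem G c L ι κ) (e f g : ι) : Prop :=
  ∃ k Z, HasCycle G Z k ∧ Z \ cycleEdges c = D.E e ∪ D.E f ∪ D.E g

/-- The interval of `g` with respect to `e` lies in that of `f`. -/
def Nests (D : EarSystem G c L ι κ) (e f g : ι) : Prop :=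
  D.lo e f ≤ D.lo e g ∧ D.hi e g ≤ D.hi e f

variable (D : EarSystem G c L ι κ)

lemma Tri.symm {D : EarSystem G c L ι κ} {e f g : ι} (h : D.Tri e f g) : D.Tri e g f := by
  obtain ⟨k, Z, h1, h2⟩ := h
  exact ⟨k, Z, h1, by rw [h2, Set.union_right_comm]⟩

lemma ear_shift (hc : CyclicParam G c L) (f : ι) :
    HasEar G c (c (D.x f + L)) (c (D.y f + L)) (D.S f) (D.E f) (D.w f) := by
  rw [hc.per, hc.per]
  exact D.ear f

lemma ear_lo_hi (hc : CyclicParam G c L) (e f : ι) :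
    HasEar G c (c (D.lo e f)) (c (D.hi e f)) (D.S f) (D.E f) (D.w f) := by
  unfold lo hi
  split_ifs
  · exact D.ear_shift hc f
  · rw [hc.per, hc.per, hc.per]
    exact (D.ear f).symm
  · rw [hc.per]
    exact (D.ear f).symm

lemma lo_lt_hi (e f : ι) : D.lo e f < D.hi e f ∧ D.hi e f < D.lo e f + L := by
  have h1 := D.x_lt f
  have h2 := D.y_lt f
  unfold lo hi
  split_ifs <;> omega

lemma base_lo_hi {e f : ι} (h : ¬ D.Crosses e f) :
    (D.x e + L ≤ D.lo e f ∧ D.hi e f ≤ D.y e + L) ∨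
      (D.lo e f ≤ D.x e + L ∧ D.y e + L ≤ D.hi e f) := by
  have h1 := D.x_lt f
  have h2 := D.y_lt f
  have h3 := D.x_lt e
  have h4 := D.y_lt e
  unfold Crosses at h
  unfold lo hi
  split_ifs <;> omega

lemma eq_of_lo_hi {e f g : ι} (h1 : D.lo e f = D.lo e g) (h2 : D.hi e f = D.hi e g) : f = g := by
  have hf1 := D.x_lt f
  have hf2 := D.y_lt f
  have hg1 := D.x_lt g
  have hg2 := D.y_lt g
  unfold lo at h1
  unfold hi at h2
  refine D.inj f g ?_ ?_ <;> split_ifs at h1 h2 <;> omega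

lemma exists_crossing {e f : ι} (hc : CyclicParam G c L) (h : D.Crosses e f) :
    ∃ A B, D.x e < A ∧ A < D.y e ∧ D.y e < B ∧ B < D.x e + L ∧
      HasEar G c (c A) (c B) (D.S f) (D.E f) (D.w f) ∧
      ((A = D.x f ∧ B = D.y f) ∨ (A = D.y f ∧ B = D.x f + L)) := by
  have h2 := D.y_lt f
  rcases h with h | h
  · exact ⟨D.x f, D.y f, h.1, h.2.1, h.2.2, by omega, D.ear f, Or.inl ⟨rfl, rfl⟩⟩
  · refine ⟨D.y f, D.x f + L, h.2.1, h.2.2, ?_, by omega, ?_, Or.inr ⟨rfl, rfl⟩⟩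
    · have := D.y_lt e
      omega
    · rw [hc.per]
      exact (D.ear f).symm

lemma tri_of_crosses (hc : CyclicParam G c L) {e f g : ι} (hef : D.cls e ≠ D.cls f)
    (heg : D.cls e ≠ D.cls g) (hfg : D.cls f ≠ D.cls g) (hf : D.Crosses e f)
    (hg : D.Crosses e g) : D.Tri e f g := by
  obtain ⟨A, B, h1, h2, h3, h4, ef, hf'⟩ := D.exists_crossing hc hf
  obtain ⟨A', B', h1', h2', h3', h4', eg, hg'⟩ := D.exists_crossing hc hg
  rcases lt_trichotomy A A' with h | h | h
  · exact HasEar.cycle_three hc (p := A) (q := B) (r := B') (s := A') (lo := D.y e)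
      (hi := D.x e + L) h1.le h h2'.le (by omega) (by omega) (by omega) (by omega)
      (D.ear e) ef eg.symm (D.compat e f hef) (D.compat e g heg) (D.compat f g hfg)
  · have hne : B ≠ B' := by
      intro hB
      have hf1 := D.x_lt f
      have hf2 := D.y_lt f
      have hg1 := D.x_lt g
      have hg2 := D.y_lt g
      refine hfg (congrArg D.cls (D.inj f g ?_ ?_)) <;> omega
    have e1 : HasEar G c (c (D.y e)) (c (D.x e + L)) (D.S e) (D.E e) (D.w e) := by
      rw [hc.per]; exact (D.ear e).symm
    have e2 : HasEar G c (c B) (c (A + L)) (D.S f) (D.E f) (D.w f) := by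
      rw [hc.per]; exact ef.symm
    have e3 : HasEar G c (c B') (c (A' + L)) (D.S g) (D.E g) (D.w g) := by
      rw [hc.per]; exact eg.symm
    rcases lt_or_gt_of_ne hne with h' | h'
    · exact HasEar.cycle_three hc (p := B) (q := A + L) (r := A' + L) (s := B')
        (lo := D.x e + L) (hi := D.y e + L) h3.le h' h4'.le (by omega) (by omega) (by omega)
        (by omega) e1 e2 e3.symm (D.compat e f hef) (D.compat e g heg) (D.compat f g hfg)
    · exact Tri.symm (HasEar.cycle_three hc (p := B') (q := A' + L) (r := A + L) (s := B)
        (lo := D.x e + L) (hi := D.y e + L) h3'.le h' h4.le (by omega) (by omega) (by omega)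
        (by omega) e1 e3 e2.symm (D.compat e g heg) (D.compat e f hef) (D.compat g f hfg.symm))
  · exact Tri.symm (HasEar.cycle_three hc (p := A') (q := B') (r := B) (s := A) (lo := D.y e)
      (hi := D.x e + L) h1'.le h h2.le (by omega) (by omega) (by omega) (by omega)
      (D.ear e) eg ef.symm (D.compat e g heg) (D.compat e f hef) (D.compat g f hfg.symm))

lemma tri_of_lt (hc : CyclicParam G c L) {e f g : ι} (hef : D.cls e ≠ D.cls f)
    (heg : D.cls e ≠ D.cls g) (hfg : D.cls f ≠ D.cls g) (hf : ¬ D.Crosses e f)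
    (hg : ¬ D.Crosses e g) (h1 : D.lo e f < D.lo e g) (h2 : D.hi e f < D.hi e g) :
    D.Tri e f g := by
  have lf := D.lo_lt_hi e f
  have lg := D.lo_lt_hi e g
  have le1 := D.x_lt e
  have le2 := D.y_lt e
  have ef := D.ear_lo_hi hc e f
  have eg := D.ear_lo_hi hc e g
  rcases D.base_lo_hi hf with bf | bf
  · have bg : D.x e + L ≤ D.lo e g ∧ D.hi e g ≤ D.y e + L := by
      rcases D.base_lo_hi hg with bg | bg <;> omega
    exact HasEar.cycle_three hc (a := D.x e + L) (b := D.y e + L) (p := D.lo e f)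
      (q := D.hi e f) (r := D.lo e g) (s := D.hi e g) (lo := D.lo e f) (hi := D.hi e g)
      bf.1 (by omega) bg.2 (by omega) (by omega) (by omega) (by omega) (D.ear_shift hc e) ef eg
      (D.compat e f hef) (D.compat e g heg) (D.compat f g hfg)
  · have bg : D.lo e g ≤ D.x e + L ∧ D.y e + L ≤ D.hi e g := by
      rcases D.base_lo_hi hg with bg | bg <;> omega
    have e1 : HasEar G c (c (D.y e + L)) (c (D.x e + L + L)) (D.S e) (D.E e) (D.w e) := by
      rw [hc.per, hc.per, hc.per]; exact (D.ear e).symm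
    have e2 : HasEar G c (c (D.hi e f)) (c (D.lo e f + L)) (D.S f) (D.E f) (D.w f) := by
      rw [hc.per]; exact ef.symm
    have e3 : HasEar G c (c (D.hi e g)) (c (D.lo e g + L)) (D.S g) (D.E g) (D.w g) := by
      rw [hc.per]; exact eg.symm
    exact HasEar.cycle_three hc (a := D.y e + L) (b := D.x e + L + L) (p := D.hi e f)
      (q := D.lo e f + L) (r := D.hi e g) (s := D.lo e g + L) (lo := D.hi e f)
      (hi := D.lo e g + L) bf.2 (by omega) (by omega) (by omega) (by omega) (by omega) (by omega)
      e1 e2 e3 (D.compat e f hef) (D.compat e g heg) (D.compat f g hfg)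

lemma tri_of_not_nests (hc : CyclicParam G c L) {e f g : ι} (hef : D.cls e ≠ D.cls f)
    (heg : D.cls e ≠ D.cls g) (hfg : D.cls f ≠ D.cls g) (hf : ¬ D.Crosses e f)
    (hg : ¬ D.Crosses e g) (h1 : ¬ D.Nests e f g) (h2 : ¬ D.Nests e g f) :
    D.Tri e f g := by
  unfold Nests at h1 h2
  rcases lt_trichotomy (D.lo e f) (D.lo e g) with h | h | h
  · exact D.tri_of_lt hc hef heg hfg hf hg h (by omega)
  · omega
  · exact (D.tri_of_lt hc heg hef hfg.symm hg hf h (by omega)).symm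

lemma cycle_of_nests (hc : CyclicParam G c L) {e f g : ι} (hfg : D.cls f ≠ D.cls g)
    (h : D.Nests e f g) :
    ∃ Z, HasCycle G Z ((D.lo e g - D.lo e f) + (D.hi e f - D.hi e g) + D.w f + D.w g) ∧
      Z \ cycleEdges c = D.E f ∪ D.E g := by
  have lf := D.lo_lt_hi e f
  have lg := D.lo_lt_hi e g
  have hne : D.lo e f < D.lo e g ∨ D.hi e g < D.hi e f := by
    by_contra h'
    exact hfg (congrArg D.cls (D.eq_of_lo_hi (e := e) (by have := h.1; omega)
      (by have := h.2; omega)))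
  exact HasEar.cycle_nested hc h.1 lg.1 h.2 lf.2 hne (D.ear_lo_hi hc e f) (D.ear_lo_hi hc e g)
    (D.compat f g hfg)

lemma lo_hi_self (e : ι) : D.lo e e = D.x e + L ∧ D.hi e e = D.y e + L := by
  unfold lo hi
  simp

/-- Two ears of different classes lie on a cycle. -/
lemma exists_cycle_pair (hc : CyclicParam G c L) {e f : ι} (hef : D.cls e ≠ D.cls f) :
    ∃ k Z, HasCycle G Z k ∧ Z \ cycleEdges c = D.E e ∪ D.E f := by
  by_cases h : D.Crosses e f
  · obtain ⟨A, B, h1, h2, h3, h4, ef, -⟩ := D.exists_crossing hc h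
    exact HasEar.cycle_cross hc h1 h2 h3 h4 (D.ear e) ef (D.compat e f hef)
  · have hs := D.lo_hi_self e
    rcases D.base_lo_hi h with hb | hb
    · obtain ⟨Z, h1, h2⟩ := D.cycle_of_nests hc (e := e) hef ⟨by rw [hs.1]; exact hb.1,
        by rw [hs.2]; exact hb.2⟩
      exact ⟨_, Z, h1, h2⟩
    · obtain ⟨Z, h1, h2⟩ := D.cycle_of_nests hc (e := e) hef.symm ⟨by rw [hs.1]; exact hb.1,
        by rw [hs.2]; exact hb.2⟩
      exact ⟨_, Z, h1, by rw [h2, Set.union_comm]⟩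

lemma mem_of_union_pair {f g : ι} (hfg : D.cls f ≠ D.cls g) {i : ι}
    (h : D.E i ⊆ D.E f ∪ D.E g) : i = f ∨ i = g := by
  have := D.ident {f, g} i (by
    intro a ha b hb hab
    rcases ha with rfl | rfl <;> rcases hb with rfl | rfl
    · rfl
    · exact absurd hab hfg
    · exact absurd hab.symm hfg
    · rfl) (by simpa using h)
  exact this

lemma mem_of_union_triple {e f g : ι} (hef : D.cls e ≠ D.cls f) (heg : D.cls e ≠ D.cls g)
    (hfg : D.cls f ≠ D.cls g) {i : ι} (h : D.E i ⊆ D.E e ∪ D.E f ∪ D.E g) :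
    i = e ∨ i = f ∨ i = g := by
  have := D.ident {e, f, g} i (by
    intro a ha b hb hab
    rcases ha with rfl | rfl | rfl <;> rcases hb with rfl | rfl | rfl <;> first
      | rfl
      | exact absurd hab (by assumption)
      | exact absurd hab.symm (by assumption)) (by simpa [Set.union_assoc] using h)
  exact this

end EarSystem

lemma HasPath.ncard {V : Type*} {G : SimpleGraph V} {a b : V} {S : Set V} {E : Set (Sym2 V)}
    {m : ℕ} (h : HasPath G a b S E m) : S.ncard = m + 1 := by
  classical
  obtain ⟨p, hp, rfl, -, rfl⟩ := h
  rw [← Walk.length_support, ← List.toFinset_card_of_nodup hp.support_nodup,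
    ← Set.ncard_coe_finset]
  congr 1
  ext v
  simp

namespace EarSystem

variable {V : Type*} {G : SimpleGraph V} {c : ℕ → V} {L : ℕ} {ι κ : Type*}
  (D : EarSystem G c L ι κ)

/-- An ear forms cycles with both arcs between its ends. -/
lemma two_mul_card_le [Fintype V] [Fintype ι] (D : EarSystem G c L ι κ)
    (hc : CyclicParam G c L) (hG : NoRepeatedCycleLengths G) :
    2 * Fintype.card ι ≤ Fintype.card V + 1 := by
  classical
  have h1 : ∀ i, ∃ k Z, HasCycle G Z k ∧ Z \ cycleEdges c = D.E i ∧
      s(c (D.x i), c (D.x i + 1)) ∈ Z := by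
    intro i
    have hx := D.x_lt i
    have hy := D.y_lt i
    obtain ⟨k, hk⟩ := (D.ear i).cycle_arc hc hx (by omega)
    refine ⟨k, _, hk, ?_, Or.inl ⟨D.x i, le_rfl, hx, rfl⟩⟩
    ext e
    constructor
    · rintro ⟨⟨t, -, -, rfl⟩ | he, he'⟩
      · exact absurd ⟨t, rfl⟩ he'
      · exact he
    · exact fun he => ⟨Or.inr he, (D.ear i).edge e he⟩
  have h2 : ∀ i, ∃ k Z, HasCycle G Z k ∧ Z \ cycleEdges c = D.E i ∧
      s(c (D.x i), c (D.x i + 1)) ∉ Z := by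
    intro i
    have hx := D.x_lt i
    have hy := D.y_lt i
    have he : HasEar G c (c (D.y i)) (c (D.x i + L)) (D.S i) (D.E i) (D.w i) := by
      rw [hc.per]; exact (D.ear i).symm
    obtain ⟨k, hk⟩ := he.cycle_arc hc (by omega) (by omega)
    refine ⟨k, _, hk, ?_, ?_⟩
    · ext e
      constructor
      · rintro ⟨⟨t, -, -, rfl⟩ | he, he'⟩
        · exact absurd ⟨t, rfl⟩ he'
        · exact he
      · exact fun he => ⟨Or.inr he, (D.ear i).edge e he⟩
    · rintro (⟨t, ht1, ht2, ht⟩ | he')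
      · have hL := hc.three_le
        rcases Sym2.eq_iff.1 ht with ⟨h3, -⟩ | ⟨h3, h4⟩
        · have := hc.eq_of_eq h3 (by omega) (by omega)
          omega
        · have := hc.eq_of_eq h4 (by omega) (by omega)
          rw [← this, add_assoc] at h3
          have := hc.eq_of_eq h3 (by omega) (by omega)
          omega
      · exact he.edge _ he' ⟨_, rfl⟩
  choose k₁ Z₁ hk₁ hZ₁ hs₁ using h1
  choose k₂ Z₂ hk₂ hZ₂ hs₂ using h2
  have hE : ∀ i j, D.E i = D.E j → i = j := by
    intro i j h
    have := D.ident {j} i (by simp) (by simp [h])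
    simpa using this
  have hinj : Function.Injective (Sum.elim k₁ k₂) := by
    rintro (i | i) (j | j) h
    · have h' : Z₁ i = Z₁ j := hG.eq (hk₁ i) (by rw [show k₁ i = k₁ j from h]; exact hk₁ j)
      rw [hE i j (by rw [← hZ₁, ← hZ₁, h'])]
    · have h' : Z₁ i = Z₂ j := hG.eq (hk₁ i) (by rw [show k₁ i = k₂ j from h]; exact hk₂ j)
      have := hE i j (by rw [← hZ₁, ← hZ₂, h'])
      subst this
      exact absurd (h' ▸ hs₁ i) (hs₂ i)
    · have h' : Z₂ i = Z₁ j := hG.eq (hk₂ i) (by rw [show k₂ i = k₁ j from h]; exact hk₁ j)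
      have := hE i j (by rw [← hZ₂, ← hZ₁, h'])
      subst this
      exact absurd (h' ▸ hs₁ i) (hs₂ i)
    · have h' : Z₂ i = Z₂ j := hG.eq (hk₂ i) (by rw [show k₂ i = k₂ j from h]; exact hk₂ j)
      rw [hE i j (by rw [← hZ₂, ← hZ₂, h'])]
  have h3 := Finset.card_le_card_of_injOn (s := (Finset.univ : Finset (ι ⊕ ι)))
    (t := Finset.range (Fintype.card V + 1)) (Sum.elim k₁ k₂) (by
      rintro (i | i) -
      · simpa using (hk₁ i).length_le
      · simpa using (hk₂ i).length_le) hinj.injOn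
  simp only [Finset.card_univ, Fintype.card_sum, Finset.card_range] at h3
  omega

lemma pair_eq {f g f' g' : ι} (h : D.cls f ≠ D.cls g) (h' : D.cls f' ≠ D.cls g')
    (hE : D.E f ∪ D.E g = D.E f' ∪ D.E g') : (f' = f ∧ g' = g) ∨ (f' = g ∧ g' = f) := by
  have h1 := D.mem_of_union_pair h (i := f') (by rw [hE]; exact Set.subset_union_left)
  have h2 := D.mem_of_union_pair h (i := g') (by rw [hE]; exact Set.subset_union_right)
  rcases h1 with rfl | rfl <;> rcases h2 with rfl | rfl
  · exact absurd rfl h'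
  · exact Or.inl ⟨rfl, rfl⟩
  · exact Or.inr ⟨rfl, rfl⟩
  · exact absurd rfl h'

lemma card_mul_card_le [Fintype V] (hc : CyclicParam G c L)
    (hG : NoRepeatedCycleLengths G) (A B : Finset ι) (hAB : ∀ a ∈ A, ∀ b ∈ B, D.cls a ≠ D.cls b) :
    A.card * B.card ≤ Fintype.card V + 1 := by
  classical
  have h1 : ∀ p : ι × ι, D.cls p.1 ≠ D.cls p.2 →
      ∃ k Z, HasCycle G Z k ∧ Z \ cycleEdges c = D.E p.1 ∪ D.E p.2 :=
    fun p hp => D.exists_cycle_pair hc hp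
  choose! k Z hk hZ using h1
  have h2 := Finset.card_le_card_of_injOn (s := A ×ˢ B)
    (t := Finset.range (Fintype.card V + 1)) k (by
      intro p hp
      obtain ⟨hp1, hp2⟩ := Finset.mem_product.1 hp
      have := (hk p (hAB _ hp1 _ hp2)).length_le
      simpa using this) (by
      intro p hp q hq hpq
      obtain ⟨hp1, hp2⟩ := Finset.mem_product.1 hp
      obtain ⟨hq1, hq2⟩ := Finset.mem_product.1 hq
      have hp' := hAB _ hp1 _ hp2
      have hq' := hAB _ hq1 _ hq2
      have h' : Z p = Z q := hG.eq (hk p hp') (by rw [hpq]; exact hk q hq')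
      rcases D.pair_eq hp' hq' (by rw [← hZ p hp', ← hZ q hq', h']) with ⟨h3, h4⟩ | ⟨h3, h4⟩
      · exact (Prod.ext h3 h4).symm
      · exact absurd (by rw [h3]) (hAB _ hq1 _ hp2))
  simpa using h2

lemma card_tri_le [Fintype V] (hG : NoRepeatedCycleLengths G)
    (T : Finset (ι × ι × ι)) (hT : ∀ p ∈ T, D.cls p.1 ≠ D.cls p.2.1 ∧
      D.cls p.1 ≠ D.cls p.2.2 ∧ D.cls p.2.1 ≠ D.cls p.2.2 ∧ D.Tri p.1 p.2.1 p.2.2) :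
    T.card ≤ 27 * (Fintype.card V + 1) := by
  classical
  have h1 : ∀ p ∈ T, ∃ k Z, HasCycle G Z k ∧
      Z \ cycleEdges c = D.E p.1 ∪ D.E p.2.1 ∪ D.E p.2.2 := fun p hp => (hT p hp).2.2.2
  choose! k Z hk hZ using h1
  have h2 := Finset.card_le_mul_card_image_of_maps_to (s := T) (f := k)
    (t := Finset.range (Fintype.card V + 1)) (by
      intro p hp
      have := (hk p hp).length_le
      simp only [Finset.mem_range]
      omega) 27 (by
      intro v _
      rcases (T.filter fun p => k p = v).eq_empty_or_nonempty with h | ⟨p, hp⟩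
      · rw [h]; simp
      obtain ⟨hp1, hp2⟩ := Finset.mem_filter.1 hp
      set A : Finset ι := {p.1, p.2.1, p.2.2} with hA
      have hAc : A.card ≤ 3 := Finset.card_le_three
      refine le_trans (Finset.card_le_card (t := A ×ˢ A ×ˢ A) ?_) ?_
      · intro q hq
        obtain ⟨hq1, hq2⟩ := Finset.mem_filter.1 hq
        have h' : Z p = Z q := hG.eq (hk p hp1) (by rw [hp2, ← hq2]; exact hk q hq1)
        have hE : D.E p.1 ∪ D.E p.2.1 ∪ D.E p.2.2 = D.E q.1 ∪ D.E q.2.1 ∪ D.E q.2.2 := by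
          rw [← hZ p hp1, ← hZ q hq1, h']
        obtain ⟨c1, c2, c3, -⟩ := hT p hp1
        have m := fun i hi => D.mem_of_union_triple c1 c2 c3 (i := i) (by rw [hE]; exact hi)
        have m1 := m q.1 (Set.subset_union_left.trans Set.subset_union_left)
        have m2 := m q.2.1 (Set.subset_union_right.trans Set.subset_union_left)
        have m3 := m q.2.2 Set.subset_union_right
        simp only [hA, Finset.mem_product, Finset.mem_insert, Finset.mem_singleton]
        exact ⟨m1, m2, m3⟩
      · rw [Finset.card_product, Finset.card_product]
        calc A.card * (A.card * A.card) ≤ 3 * (3 * 3) := by gcongr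
          _ = 27 := rfl)
  simpa using h2

lemma card_long_mul_le [Fintype V] (A : Finset ι) (hA : Set.InjOn D.cls A) (W : ℕ)
    (hW : ∀ a ∈ A, W + 2 ≤ D.w a) : A.card * W ≤ Fintype.card V := by
  classical
  set f : ι → Finset V := fun i => Finset.univ.filter fun v => v ∈ D.S i ∧ ∀ t, v ≠ c t with hf
  have h1 : ∀ a ∈ A, W ≤ (f a).card := by
    intro a ha
    have h2 := (D.ear a).path.ncard
    rw [Set.ncard_eq_toFinset_card'] at h2
    have h3 : (D.S a).toFinset ⊆ f a ∪ {c (D.x a), c (D.y a)} := by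
      intro v hv
      rw [Set.mem_toFinset] at hv
      by_cases hv' : ∀ t, v ≠ c t
      · exact Finset.mem_union_left _ (Finset.mem_filter.2 ⟨Finset.mem_univ _, hv, hv'⟩)
      · push Not at hv'
        obtain ⟨t, rfl⟩ := hv'
        refine Finset.mem_union_right _ ?_
        simpa using (D.ear a).ends t hv
    have h4 := (Finset.card_le_card h3).trans (Finset.card_union_le _ _)
    have h5 : ({c (D.x a), c (D.y a)} : Finset V).card ≤ 2 := Finset.card_le_two
    have := hW a ha
    omega
  have h2 : (A.biUnion f).card = ∑ a ∈ A, (f a).card := by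
    refine Finset.card_biUnion ?_
    intro a ha b hb hab
    refine Finset.disjoint_left.2 fun v hva hvb => ?_
    have hva := (Finset.mem_filter.1 hva).2
    have hvb := (Finset.mem_filter.1 hvb).2
    obtain ⟨t, ht⟩ := D.compat a b (fun h => hab (hA ha hb h)) v hva.1 hvb.1
    exact hva.2 t ht
  calc A.card * W = ∑ a ∈ A, W := by simp
    _ ≤ ∑ a ∈ A, (f a).card := Finset.sum_le_sum h1
    _ = (A.biUnion f).card := h2.symm
    _ ≤ _ := Finset.card_le_univ _

end EarSystem

lemma CyclicParam.le_card {V : Type*} [Fintype V] {G : SimpleGraph V} {c : ℕ → V} {L : ℕ}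
    (hc : CyclicParam G c L) : L ≤ Fintype.card V := by
  have := Fintype.card_le_of_injective (fun t : Fin L => c t)
    (fun s t h => Fin.ext (hc.inj _ s.2 _ t.2 h))
  simpa using this

namespace EarSystem

variable {V : Type*} {G : SimpleGraph V} {c : ℕ → V} {L : ℕ} {ι κ : Type*}
  (D : EarSystem G c L ι κ)

/-- The span of the interval of `f` with respect to `e`. -/
noncomputable def span (e f : ι) : ℕ := D.hi e f - D.lo e f

open Classical in
/-- Ordered pairs from `R` forming a triple with `e` on a common cycle. -/
noncomputable def triPairs (R : Finset ι) (e : ι) : Finset (ι × ι) :=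
  (R ×ˢ R).filter fun p => D.cls e ≠ D.cls p.1 ∧ D.cls e ≠ D.cls p.2 ∧ D.cls p.1 ≠ D.cls p.2 ∧
    D.Tri e p.1 p.2

lemma exists_card_triPairs_le [Fintype V] (hG : NoRepeatedCycleLengths G) (R : Finset ι)
    (hR : R.Nonempty) :
    ∃ e ∈ R, (D.triPairs R e).card * R.card ≤ 27 * (Fintype.card V + 1) := by
  classical
  obtain ⟨e, he, hmin⟩ := R.exists_min_image (fun e => (D.triPairs R e).card) hR
  refine ⟨e, he, ?_⟩
  have h1 := D.card_tri_le hG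
    (R.biUnion fun e => (D.triPairs R e).map ⟨_, Prod.mk_right_injective e⟩) (by
      intro p hp
      simp only [Finset.mem_biUnion, Finset.mem_map, Function.Embedding.coeFn_mk] at hp
      obtain ⟨f, hf, q, hq, rfl⟩ := hp
      have := (Finset.mem_filter.1 hq).2
      tauto)
  rw [Finset.card_biUnion] at h1
  · simp only [Finset.card_map] at h1
    refine le_trans ?_ h1
    rw [mul_comm, ← smul_eq_mul]
    exact Finset.card_nsmul_le_sum _ _ _ hmin
  · intro f _ g _ hfg
    refine Finset.disjoint_left.2 fun p hp hp' => hfg ?_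
    simp only [Finset.mem_map, Function.Embedding.coeFn_mk] at hp hp'
    obtain ⟨q, -, rfl⟩ := hp
    obtain ⟨q', -, h⟩ := hp'
    exact (congrArg Prod.fst h).symm

open Classical in
lemma sq_card_crosses_le (hc : CyclicParam G c L) (R : Finset ι) (e : ι) (h : ℕ)
    (hR : ∀ k, (R.filter fun f => D.cls f = k).card ≤ h) :
    (R.filter fun f => D.cls e ≠ D.cls f ∧ D.Crosses e f).card ^ 2 ≤
      (D.triPairs R e).card + (R.filter fun f => D.cls e ≠ D.cls f ∧ D.Crosses e f).card * h := by
  set X := R.filter fun f => D.cls e ≠ D.cls f ∧ D.Crosses e f with hX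
  have h1 : X ×ˢ X ⊆ D.triPairs R e ∪ X.biUnion fun f => (X.filter fun g => D.cls g = D.cls f).map
      ⟨_, Prod.mk_right_injective f⟩ := by
    rintro ⟨f, g⟩ hp
    obtain ⟨hf, hg⟩ := Finset.mem_product.1 hp
    obtain ⟨hf1, hf2, hf3⟩ := Finset.mem_filter.1 hf
    obtain ⟨hg1, hg2, hg3⟩ := Finset.mem_filter.1 hg
    by_cases hfg : D.cls f = D.cls g
    · refine Finset.mem_union_right _ (Finset.mem_biUnion.2 ⟨f, hf, ?_⟩)
      simp only [Finset.mem_map, Finset.mem_filter, Function.Embedding.coeFn_mk]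
      exact ⟨g, ⟨hg, hfg.symm⟩, rfl⟩
    · exact Finset.mem_union_left _ (Finset.mem_filter.2 ⟨Finset.mem_product.2 ⟨hf1, hg1⟩,
        hf2, hg2, hfg, D.tri_of_crosses hc hf2 hg2 hfg hf3 hg3⟩)
  have h2 := (Finset.card_le_card h1).trans (Finset.card_union_le _ _)
  have h3 : (X.biUnion fun f => (X.filter fun g => D.cls g = D.cls f).map
      ⟨_, Prod.mk_right_injective f⟩).card ≤ X.card * h := by
    refine Finset.card_biUnion_le_card_mul _ _ _ fun f _ => ?_
    rw [Finset.card_map]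
    exact (Finset.card_le_card (Finset.filter_subset_filter _ (Finset.filter_subset _ _))).trans
      (hR _)
  rw [Finset.card_product] at h2
  rw [sq]
  omega

open Classical in
lemma card_long_le [Fintype V] (R : Finset ι) (h W : ℕ)
    (hR : ∀ k, (R.filter fun f => D.cls f = k).card ≤ h) :
    (R.filter fun f => W + 2 ≤ D.w f).card * W ≤ h * Fintype.card V := by
  set Y := R.filter fun f => W + 2 ≤ D.w f with hY
  obtain ⟨A, hA1, hA2, hA3⟩ := Finset.exists_subset_injOn_image_eq_of_surjOn
    (s := Y) (t := Y.image D.cls) (f := D.cls) (by simpa using Set.surjOn_image _ _)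
  have h1 := D.card_long_mul_le A hA2 W fun a ha => (Finset.mem_filter.1 (hA1 ha)).2
  have h2 := Finset.card_le_mul_card_image (f := D.cls) Y h fun k _ =>
    (Finset.card_le_card (Finset.filter_subset_filter _ (Finset.filter_subset _ _))).trans (hR k)
  have h3 : (Y.image D.cls).card = A.card := by
    rw [← hA3, Finset.card_image_of_injOn hA2]
  rw [h3] at h2
  calc Y.card * W ≤ h * A.card * W := Nat.mul_le_mul_right _ h2
    _ = h * (A.card * W) := by ring
    _ ≤ _ := Nat.mul_le_mul_left _ h1

open Classical in
/-- Window counting for the spans of short ears not crossing `e`. -/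
lemma window_bound [Fintype V] (hc : CyclicParam G c L) (hG : NoRepeatedCycleLengths G)
    (R J : Finset ι) (hJ : J ⊆ R) (e : ι) (h W u : ℕ)
    (hR : ∀ k, (R.filter fun f => D.cls f = k).card ≤ h)
    (he : ∀ f ∈ J, D.cls e ≠ D.cls f) (hcr : ∀ f ∈ J, ¬ D.Crosses e f)
    (hw : ∀ f ∈ J, D.w f ≤ W + 1) :
    (J.card * u) ^ 2 ≤ (Fintype.card V + u) *
      (J.card * u + (J.card * h + (D.triPairs R e).card) * u + (u + 2 * (W + 1)) ^ 2) := by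
  set Bad := (J ×ˢ J).filter fun p => D.cls p.1 = D.cls p.2 ∨
    (¬ D.Nests e p.1 p.2 ∧ ¬ D.Nests e p.2 p.1) with hBad
  have hwpos : ∀ f, 1 ≤ D.w f := fun f => (D.ear f).path.length_pos fun h => by
    have := hc.eq_of_eq h (by have := D.x_lt f; omega) (by have := D.y_lt f; omega)
    have := D.x_lt f
    omega
  have hcyc : ∀ f ∈ J, ∀ g ∈ J, (f, g) ∉ Bad → D.cls f ≠ D.cls g ∧ ∃ Z, HasCycle G Z
      ((D.span e f - D.span e g) + (D.span e g - D.span e f) + D.w f + D.w g) ∧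
        Z \ cycleEdges c = D.E f ∪ D.E g := by
    intro f hf g hg hb
    have h1 : ¬ (D.cls f = D.cls g ∨ (¬ D.Nests e f g ∧ ¬ D.Nests e g f)) := fun h' =>
      hb (Finset.mem_filter.2 ⟨Finset.mem_product.2 ⟨hf, hg⟩, h'⟩)
    push Not at h1
    refine ⟨h1.1, ?_⟩
    have lf := D.lo_lt_hi e f
    have lg := D.lo_lt_hi e g
    by_cases h2 : D.Nests e f g
    · obtain ⟨Z, h3, h4⟩ := D.cycle_of_nests hc h1.1 h2
      refine ⟨Z, ?_, h4⟩
      convert h3 using 1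
      obtain ⟨h5, h6⟩ := h2
      unfold span
      omega
    · have h2 := h1.2 h2
      obtain ⟨Z, h3, h4⟩ := D.cycle_of_nests hc (Ne.symm h1.1) h2
      refine ⟨Z, ?_, by rw [h4, Set.union_comm]⟩
      convert h3 using 1
      obtain ⟨h5, h6⟩ := h2
      unfold span
      omega
  have hBadc : Bad.card ≤ J.card * h + (D.triPairs R e).card := by
    have h1 : Bad ⊆ (J.biUnion fun f => (J.filter fun g => D.cls g = D.cls f).map
        ⟨_, Prod.mk_right_injective f⟩) ∪ D.triPairs R e := by
      rintro ⟨f, g⟩ hp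
      obtain ⟨hfg, hb⟩ := Finset.mem_filter.1 hp
      obtain ⟨hf, hg⟩ := Finset.mem_product.1 hfg
      by_cases hfg : D.cls f = D.cls g
      · refine Finset.mem_union_left _ (Finset.mem_biUnion.2 ⟨f, hf, ?_⟩)
        simp only [Finset.mem_map, Finset.mem_filter, Function.Embedding.coeFn_mk]
        exact ⟨g, ⟨hg, hfg.symm⟩, rfl⟩
      · have hb := hb.resolve_left hfg
        exact Finset.mem_union_right _ (Finset.mem_filter.2
          ⟨Finset.mem_product.2 ⟨hJ hf, hJ hg⟩, he f hf, he g hg, hfg,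
            D.tri_of_not_nests hc (he f hf) (he g hg) hfg (hcr f hf) (hcr g hg) hb.1 hb.2⟩)
    refine ((Finset.card_le_card h1).trans (Finset.card_union_le _ _)).trans ?_
    refine Nat.add_le_add_right ?_ _
    refine Finset.card_biUnion_le_card_mul _ _ _ fun f _ => ?_
    rw [Finset.card_map]
    exact (Finset.card_le_card (Finset.filter_subset_filter _ hJ)).trans (hR _)
  have hmain := card_le_of_distinct_differences J (D.span e) (Fintype.card V) u (2 * (W + 1))
    (fun f _ => by
      have := D.lo_lt_hi e f
      have := hc.le_card
      unfold span
      omega) Bad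
    (fun f g => (D.span e f - D.span e g) + (D.span e g - D.span e f) + D.w f + D.w g)
    (by
      intro f hf g hg _ _
      have := hw f hf
      have := hw g hg
      have := hwpos f
      omega)
    (by
      intro f hf g hg _ hb f' hf' g' hg' _ hb' heq
      obtain ⟨c1, Z, hZ, hE⟩ := hcyc f hf g hg hb
      obtain ⟨c1', Z', hZ', hE'⟩ := hcyc f' hf' g' hg' hb'
      have h' : Z = Z' := hG.eq hZ (by rw [heq]; exact hZ')
      exact D.pair_eq c1 c1' (by rw [← hE, ← hE', h']))
  refine hmain.trans ?_
  gcongr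

open Classical in
lemma exists_bounds [Fintype V] (hc : CyclicParam G c L) (hG : NoRepeatedCycleLengths G)
    (R : Finset ι) (hne : R.Nonempty) (h W u : ℕ)
    (hR : ∀ k, (R.filter fun f => D.cls f = k).card ≤ h) :
    ∃ N x y j : ℕ, N * R.card ≤ 27 * (Fintype.card V + 1) ∧ x ^ 2 ≤ N + x * h ∧
      y * W ≤ h * Fintype.card V ∧ R.card ≤ j + h + x + y ∧
      (j * u) ^ 2 ≤ (Fintype.card V + u) * (j * u + (j * h + N) * u + (u + 2 * (W + 1)) ^ 2) := by
  obtain ⟨e, heR, he⟩ := D.exists_card_triPairs_le hG R hne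
  set J := R.filter fun f => D.cls e ≠ D.cls f ∧ ¬ D.Crosses e f ∧ D.w f ≤ W + 1 with hJ
  refine ⟨_, _, _, J.card, he, D.sq_card_crosses_le hc R e h hR, D.card_long_le R h W hR, ?_,
    D.window_bound hc hG R J (Finset.filter_subset _ _) e h W u hR
      (fun f hf => (Finset.mem_filter.1 hf).2.1) (fun f hf => (Finset.mem_filter.1 hf).2.2.1)
      (fun f hf => (Finset.mem_filter.1 hf).2.2.2)⟩
  have h1 : R ⊆ J ∪ (R.filter fun f => D.cls f = D.cls e) ∪
      (R.filter fun f => D.cls e ≠ D.cls f ∧ D.Crosses e f) ∪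
      (R.filter fun f => W + 2 ≤ D.w f) := by
    intro f hf
    simp only [hJ, Finset.mem_union, Finset.mem_filter, hf, true_and]
    have : D.w f ≤ W + 1 ∨ W + 2 ≤ D.w f := by omega
    by_cases h1 : D.cls e = D.cls f
    · exact Or.inl (Or.inl (Or.inr h1.symm))
    · tauto
  have h2 := Finset.card_le_card h1
  have h3 := Finset.card_union_le (J ∪ (R.filter fun f => D.cls f = D.cls e) ∪
      (R.filter fun f => D.cls e ≠ D.cls f ∧ D.Crosses e f)) (R.filter fun f => W + 2 ≤ D.w f)
  have h4 := Finset.card_union_le (J ∪ (R.filter fun f => D.cls f = D.cls e))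
      (R.filter fun f => D.cls e ≠ D.cls f ∧ D.Crosses e f)
  have h5 := Finset.card_union_le J (R.filter fun f => D.cls f = D.cls e)
  have h6 := hR (D.cls e)
  omega

open Classical in
/-- A class containing `r` of the rooted ears leaves room for few others. -/
lemma card_le_of_big_class [Fintype V] [Fintype ι] (hc : CyclicParam G c L)
    (hG : NoRepeatedCycleLengths G) (R : Finset ι) (k : κ)
    (hk : (R.filter fun f => D.cls f = k).card * ((R.filter fun f => D.cls f = k).card + 1) ≤
      2 * (Finset.univ.filter fun f => D.cls f = k).card) :
    (R.filter fun f => D.cls f = k).card ^ 2 ≤ Fintype.card V + 1 ∧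
    (R.filter fun f => D.cls f = k).card ^ 2 *
      (R.card - (R.filter fun f => D.cls f = k).card) ≤ 2 * (Fintype.card V + 1) := by
  set r := (R.filter fun f => D.cls f = k).card with hr
  have h1 := D.two_mul_card_le hc hG
  have h2 : (Finset.univ.filter fun f => D.cls f = k).card ≤ Fintype.card ι :=
    Finset.card_le_univ _
  have h3 := D.card_mul_card_le hc hG (Finset.univ.filter fun f => D.cls f = k)
    (R.filter fun f => ¬ D.cls f = k) (by
      intro a ha b hb hab
      exact (Finset.mem_filter.1 hb).2 (hab ▸ (Finset.mem_filter.1 ha).2))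
  have h4 := Finset.card_filter_add_card_filter_not (s := R) (fun f => D.cls f = k)
  have h5 : (R.filter fun f => ¬ D.cls f = k).card = R.card - r := by omega
  rw [h5] at h3
  constructor
  · nlinarith
  · calc r ^ 2 * (R.card - r) ≤ (2 * (Finset.univ.filter fun f => D.cls f = k).card) *
          (R.card - r) := Nat.mul_le_mul_right _ (by nlinarith)
      _ = 2 * ((Finset.univ.filter fun f => D.cls f = k).card * (R.card - r)) := by ring
      _ ≤ _ := Nat.mul_le_mul_left _ h3

end EarSystem

lemma lt_of_window_bound {r n u j h N k : ℝ} (hr : 10 ^ 26 ≤ r) (hn : n = r ^ 2) (hh0 : 0 ≤ h)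
    (hh : h ≤ r / 10 ^ 11) (hN0 : 0 ≤ N) (hN : N ≤ 27 * r) (hk : k ≤ n / 10 ^ 7 + 1)
    (hk0 : 0 ≤ k)
    (hu : n / 1000 ≤ u) (hu' : u ≤ n / 1000 + 1) (hj0 : 0 ≤ j)
    (hw : (j * u) ^ 2 ≤ (n + u) * (j * u + (j * h + N) * u + (u + 2 * (k + 1)) ^ 2)) :
    j < 1.0047 * r := by
  by_contra! hj
  have hr0 : 0 < r := by linarith
  have hn1 : 10 ^ 26 * r ≤ n := by rw [hn, sq]; gcongr
  have hn0 : 0 < n := by nlinarith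
  have hu0 : 0 < u := by linarith
  have h1 : n + u ≤ 1001 * u := by linarith
  have h2 : n + u ≤ 1.0011 * n := by nlinarith
  have h3 : u + 2 * (k + 1) ≤ 1.00021 * u := by nlinarith
  have h4 : (u + 2 * (k + 1)) ^ 2 ≤ (1.00021 * u) ^ 2 := by gcongr
  have h5 : (n + u) * (j * u + (j * h + N) * u + (u + 2 * (k + 1)) ^ 2) ≤
      (1001 * (j + j * h + N) + 1.0011 * n * 1.00021 ^ 2) * u ^ 2 := by
    calc _ = (n + u) * ((j + j * h + N) * u) + (n + u) * (u + 2 * (k + 1)) ^ 2 := by ring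
      _ ≤ (1001 * u) * ((j + j * h + N) * u) + (1.0011 * n) * (1.00021 * u) ^ 2 := by
        gcongr
      _ = _ := by ring
  have h6 : j ^ 2 ≤ 1001 * (j + j * h + N) + 1.0011 * n * 1.00021 ^ 2 := by
    refine le_of_mul_le_mul_right ?_ (pow_pos hu0 2)
    rw [← mul_pow]
    exact hw.trans h5
  have h7 : j * h ≤ j * (r / 10 ^ 11) := by gcongr
  have h8 : 1.0046 * r ≤ j - 1001 * (r / 10 ^ 11) - 1001 := by linarith
  have h9 : 1.0047 * r * (1.0046 * r) ≤ j * (j - 1001 * (r / 10 ^ 11) - 1001) := by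
    gcongr
  have h10 : 10 ^ 26 * r ≤ r ^ 2 := hn ▸ hn1
  rw [hn] at h6
  norm_num at h6 h9
  nlinarith

lemma lt_of_small_classes {r n : ℝ} {N x y h R k : ℝ} (hr : 10 ^ 26 ≤ r) (hn : n = r ^ 2)
    (hN0 : 0 ≤ N) (hx0 : 0 ≤ x)
    (hh : h ≤ r / 10 ^ 11) (hk : n / 10 ^ 7 ≤ k) (hy0 : 0 ≤ y)
    (hR : 1.005 * r ≤ R) (h1 : N * R ≤ 27 * (n + 1)) (h2 : x ^ 2 ≤ N + x * h)
    (h3 : y * k ≤ h * n) : N ≤ 27 * r ∧ h + x + y ≤ 0.0003 * r := by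
  have hr0 : 0 < r := by linarith
  have hn1 : 10 ^ 26 * r ≤ n := by rw [hn, sq]; gcongr
  have hN : N ≤ 27 * r := by
    by_contra! hN
    have : 27 * r * (1.005 * r) ≤ N * R := by gcongr
    nlinarith
  have hx : x ≤ r / 10000 := by
    by_contra! hx
    have h4 : x * h ≤ x * (r / 10 ^ 11) := by gcongr
    have h5 : x * (r / 10000) ≤ x ^ 2 := by rw [sq]; gcongr
    have h6 : r / 10000 * r ≤ x * r := by gcongr
    nlinarith
  have hy : y ≤ r / 10000 := by
    have h4 : y * (n / 10 ^ 7) ≤ y * k := by gcongr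
    have h5 : h * n ≤ r / 10 ^ 11 * n := by gcongr; linarith
    have h6 : y * n ≤ r / 10000 * n := by nlinarith
    exact le_of_mul_le_mul_right h6 (by nlinarith)
  exact ⟨hN, by linarith⟩

namespace EarSystem

open Classical in
theorem card_le {V : Type*} {G : SimpleGraph V} {c : ℕ → V} {L : ℕ} {ι κ : Type*}
    (D : EarSystem G c L ι κ) [Fintype V] [Fintype ι] (hc : CyclicParam G c L)
    (hG : NoRepeatedCycleLengths G) (R : Finset ι)
    (hR : ∀ k, (R.filter fun f => D.cls f = k).card * ((R.filter fun f => D.cls f = k).card + 1) ≤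
      2 * (Finset.univ.filter fun f => D.cls f = k).card)
    (hn : (10 : ℝ) ^ 26 ≤ √(Fintype.card V)) :
    (R.card : ℝ) ≤ 1.005 * √(Fintype.card V) := by
  set r : ℝ := √(Fintype.card V) with hr
  have hrn : (Fintype.card V : ℝ) = r ^ 2 := (Real.sq_sqrt (Nat.cast_nonneg _)).symm
  have hr0 : 0 < r := by linarith
  by_contra! hlt
  by_cases hbig : ∀ k, (R.filter fun f => D.cls f = k).card ≤ ⌊r / 10 ^ 11⌋₊
  · have hne : R.Nonempty := by
      rw [← Finset.card_pos, ← Nat.cast_pos (α := ℝ)]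
      linarith
    obtain ⟨N, x, y, j, h1, h2, h3, h4, h5⟩ := D.exists_bounds hc hG R hne ⌊r / 10 ^ 11⌋₊
      ⌈(Fintype.card V : ℝ) / 10 ^ 7⌉₊ ⌈(Fintype.card V : ℝ) / 1000⌉₊ hbig
    have hh : ((⌊r / 10 ^ 11⌋₊ : ℕ) : ℝ) ≤ r / 10 ^ 11 := Nat.floor_le (by positivity)
    have hk := Nat.le_ceil ((Fintype.card V : ℝ) / 10 ^ 7)
    have hk' := (Nat.ceil_lt_add_one (a := (Fintype.card V : ℝ) / 10 ^ 7) (by positivity)).le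
    have hu := Nat.le_ceil ((Fintype.card V : ℝ) / 1000)
    have hu' := (Nat.ceil_lt_add_one (a := (Fintype.card V : ℝ) / 1000) (by positivity)).le
    generalize ⌊r / 10 ^ 11⌋₊ = h at *
    generalize ⌈(Fintype.card V : ℝ) / 10 ^ 7⌉₊ = k at *
    generalize ⌈(Fintype.card V : ℝ) / 1000⌉₊ = u at *
    have h1' : (N : ℝ) * R.card ≤ 27 * (Fintype.card V + 1) := by exact_mod_cast h1
    have h2' : (x : ℝ) ^ 2 ≤ N + x * h := by exact_mod_cast h2
    have h3' : (y : ℝ) * k ≤ h * Fintype.card V := by exact_mod_cast h3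
    have h4' : (R.card : ℝ) ≤ j + h + x + y := by exact_mod_cast h4
    have h5' : ((j : ℝ) * u) ^ 2 ≤ (Fintype.card V + u) *
      (j * u + (j * h + N) * u + (u + 2 * (k + 1)) ^ 2) := by exact_mod_cast h5
    obtain ⟨h6, h7⟩ := lt_of_small_classes hn hrn (Nat.cast_nonneg N) (Nat.cast_nonneg x) hh hk
      (Nat.cast_nonneg y) hlt.le h1' h2' h3'
    have h8 := lt_of_window_bound hn hrn (Nat.cast_nonneg h) hh (Nat.cast_nonneg N) h6 hk'
      (Nat.cast_nonneg k) hu hu' (Nat.cast_nonneg j) h5'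
    linarith
  · push Not at hbig
    obtain ⟨k, hk⟩ := hbig
    obtain ⟨h1, h2⟩ := D.card_le_of_big_class hc hG R k (hR k)
    have h3 : (R.filter fun f => D.cls f = k).card ≤ R.card := Finset.card_filter_le _ _
    generalize (R.filter fun f => D.cls f = k).card = s at *
    obtain ⟨d, hd⟩ := Nat.exists_eq_add_of_le h3
    rw [hd, Nat.add_sub_cancel_left] at h2
    have hs := Nat.lt_of_floor_lt hk
    have h1' : (s : ℝ) ^ 2 ≤ Fintype.card V + 1 := by exact_mod_cast h1
    have h2' : (s : ℝ) ^ 2 * d ≤ 2 * (Fintype.card V + 1) := by exact_mod_cast h2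
    have hd' : (R.card : ℝ) = s + d := by exact_mod_cast hd
    rw [hrn] at h1' h2'
    have h4 : (s : ℝ) ≤ r + 1 := by
      refine le_of_sq_le_sq ?_ (by positivity)
      nlinarith
    have h5 : (r / 10 ^ 11) ^ 2 * d ≤ (s : ℝ) ^ 2 * d := by gcongr
    have h6 : (d : ℝ) ≤ 4 * 10 ^ 22 := by
      have : r ^ 2 * d ≤ r ^ 2 * (4 * 10 ^ 22) := by nlinarith
      exact le_of_mul_le_mul_left this (by positivity)
    rw [hd'] at hlt
    linarith

end EarSystem

lemma SimpleGraph.IsAcyclic.isPath_eq {V : Type*} {H : SimpleGraph V} (hH : H.IsAcyclic) {a b : V}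
    {p q : H.Walk a b} (hp : p.IsPath) (hq : q.IsPath) : p = q :=
  congrArg Subtype.val ((hH.subsingleton_path a b).elim ⟨p, hp⟩ ⟨q, hq⟩)

lemma SimpleGraph.IsAcyclic.ncard_edgeSet_add_card_le {V : Type*} [Finite V] {H : SimpleGraph V}
    (hH : H.IsAcyclic) :
    H.edgeSet.ncard + Nat.card H.ConnectedComponent ≤ Nat.card V := by
  choose r hr using fun K : H.ConnectedComponent => K.exists_rep
  have hr' : ∀ v, H.Reachable v (r (H.connectedComponentMk v)) := fun v =>
    ConnectedComponent.exact (hr _).symm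
  choose p hp using fun v => (hr' v).exists_isPath
  set N : Set V := (Set.range r)ᶜ with hN
  have h1 : H.edgeSet ⊆ (fun v => s(v, (p v).snd)) '' N := by
    intro e
    induction e with | _ a b => ?_
    intro hab
    rw [mem_edgeSet] at hab
    have key : ∀ a b, H.Adj a b → b ∈ (p a).support →
        s(a, b) ∈ (fun v => s(v, (p v).snd)) '' N := by
      intro a b hab hb
      refine ⟨a, ?_, by dsimp only; rw [← hH.eq_snd_of_adj_start (hp a) hab hb]⟩
      rintro ⟨K, rfl⟩
      have h3 : ∀ (x : V) (q : H.Walk (r K) x), x = r K → q.IsPath → b ∈ q.support → False := by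
        rintro _ q rfl hq hb
        have := hH.isPath_eq hq Walk.IsPath.nil
        rw [this, Walk.support_nil, List.mem_singleton] at hb
        exact hab.ne hb.symm
      exact h3 _ _ (congrArg r (hr K)) (hp _) hb
    by_cases hb : b ∈ (p a).support
    · exact key a b hab hb
    · rw [Sym2.eq_swap]
      refine key b a hab.symm ?_
      have h2 : H.connectedComponentMk a = H.connectedComponentMk b :=
        ConnectedComponent.sound hab.reachable
      have h3 : ∀ (x y : V) (q : H.Walk a x) (q' : H.Walk b y), x = y → q.IsPath → q'.IsPath →
          b ∉ q.support → a ∈ q'.support := by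
        rintro x _ q q' rfl hq hq' hb
        rw [hH.isPath_eq hq' (hq.cons hb (h := hab.symm))]
        simp
      exact h3 _ _ _ _ (congrArg r h2) (hp a) (hp b) hb
  have h2 := (Set.ncard_le_ncard h1).trans (Set.ncard_image_le (Set.toFinite N))
  have hinj : Function.Injective r := fun K K' h => by rw [← hr K, ← hr K', h]
  have h3 : (Set.range r).ncard = Nat.card H.ConnectedComponent := by
    rw [← Set.image_univ, Set.ncard_image_of_injective _ hinj, Set.ncard_univ]
  have h4 := Set.ncard_add_ncard_compl (Set.range r)
  rw [← hN, h3] at h4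
  omega

section Ears

variable {V : Type*} {F G : SimpleGraph V} {c : ℕ → V} {L : ℕ}

/-- The part of `F` off the image of `c`. -/
def innerGraph (F : SimpleGraph V) (c : ℕ → V) : SimpleGraph V where
  Adj a b := F.Adj a b ∧ a ∉ Set.range c ∧ b ∉ Set.range c
  symm := ⟨fun _ _ h => ⟨h.1.symm, h.2.2, h.2.1⟩⟩
  loopless := ⟨fun _ h => h.1.ne rfl⟩

lemma innerGraph_le (F : SimpleGraph V) (c : ℕ → V) : innerGraph F c ≤ F := fun _ _ h => h.1

lemma notMem_of_mem_support_innerGraph {a b : V} (p : (innerGraph F c).Walk a b)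
    (ha : a ∉ Set.range c) : ∀ v ∈ p.support, v ∉ Set.range c := by
  induction p with
  | nil => simpa using ha
  | cons h p ih =>
    intro v hv
    rcases List.mem_cons.1 (by simpa using hv) with rfl | hv
    · exact ha
    · exact ih h.2.2 v hv

/-- A path meeting the image of `c` only in its ends. -/
structure IsEar (c : ℕ → V) {a b : V} (q : F.Walk a b) : Prop where
  isPath : q.IsPath
  ends : ∀ t, c t ∈ q.support → c t = a ∨ c t = b

namespace IsEar

variable {a b : V} {q : F.Walk a b}

lemma reverse (h : IsEar c q) : IsEar c q.reverse :=
  ⟨h.isPath.reverse, fun t ht => (h.ends t (by simpa using ht)).symm⟩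

lemma reachable (h : IsEar c q) {v w : V} (hv : v ∈ q.support) (hw : w ∈ q.support)
    (hv' : v ∉ Set.range c) (hw' : w ∉ Set.range c) : (innerGraph F c).Reachable v w := by
  have key : ∀ k l, k ≤ l → l ≤ q.length → q.getVert k ∉ Set.range c →
      q.getVert l ∉ Set.range c → (innerGraph F c).Reachable (q.getVert k) (q.getVert l) := by
    intro k l hkl
    induction l, hkl using Nat.le_induction with
    | base => exact fun _ _ _ => Reachable.refl _
    | succ l hkl ih =>
      intro hl hk hl'
      by_cases hlc : q.getVert l ∈ Set.range c
      · exfalso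
        obtain ⟨t, ht⟩ := hlc
        have h1 := h.ends t (ht ▸ q.getVert_mem_support l)
        rw [ht] at h1
        rcases h1 with h1 | h1
        · have h2 : l = 0 := h.isPath.getVert_injOn (by simp; omega) (by simp) (by simpa using h1)
          obtain rfl : k = l := by omega
          exact hk ⟨t, ht⟩
        · have h2 : l = q.length :=
            h.isPath.getVert_injOn (by simp; omega) (by simp) (by simpa using h1)
          omega
      · refine (ih (by omega) hk hlc).trans (Adj.reachable ?_)
        exact ⟨q.adj_getVert_succ (by omega), hlc, hl'⟩
  obtain ⟨k, rfl, hk⟩ := Walk.mem_support_iff_exists_getVert.1 hv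
  obtain ⟨l, rfl, hl⟩ := Walk.mem_support_iff_exists_getVert.1 hw
  rcases le_total k l with hkl | hkl
  · exact key k l hkl hl hv' hw'
  · exact (key l k hkl hk hw' hv').symm

lemma snd (h : IsEar c q) (ha : a ∈ Set.range c) (hb : b ∈ Set.range c) {v : V}
    (hv : v ∈ q.support) (hv' : v ∉ Set.range c) : F.Adj a q.snd ∧ q.snd ∉ Set.range c := by
  obtain ⟨k, rfl, hk⟩ := Walk.mem_support_iff_exists_getVert.1 hv
  have hk0 : k ≠ 0 := by rintro rfl; exact hv' (by simpa using ha)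
  have hkl : k ≠ q.length := by rintro rfl; exact hv' (by simpa using hb)
  refine ⟨q.adj_snd fun hn => by have := Walk.length_eq_zero_iff.2 hn; omega, ?_⟩
  rintro ⟨t, ht⟩
  have h1 := h.ends t (by rw [ht]; exact q.getVert_mem_support 1)
  rw [ht] at h1
  rcases h1 with h1 | h1
  · have : 1 = 0 := h.isPath.getVert_injOn (by simp; omega) (by simp) (by simpa using h1)
    omega
  · have : 1 = q.length := h.isPath.getVert_injOn (by simp; omega) (by simp) (by simpa using h1)
    omega

lemma penultimate (h : IsEar c q) (ha : a ∈ Set.range c) (hb : b ∈ Set.range c) {v : V}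
    (hv : v ∈ q.support) (hv' : v ∉ Set.range c) :
    F.Adj b q.penultimate ∧ q.penultimate ∉ Set.range c := by
  have := h.reverse.snd hb ha (by simpa using hv) hv'
  simpa using this

end IsEar

lemma exists_isEar {a b x y : V} (ha : a ∈ Set.range c) (hb : b ∈ Set.range c) (hab : a ≠ b)
    (hx : x ∉ Set.range c) (hax : F.Adj a x) (hby : F.Adj b y)
    (hxy : (innerGraph F c).Reachable x y) :
    ∃ q : F.Walk a b, IsEar c q ∧ x ∈ q.support ∧ q.penultimate = y := by
  obtain ⟨p, hp⟩ := hxy.exists_isPath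
  have hs := notMem_of_mem_support_innerGraph p hx
  have hp' : (p.mapLe (innerGraph_le F c)).IsPath := hp.mapLe _
  refine ⟨Walk.cons hax ((p.mapLe (innerGraph_le F c)).concat hby.symm), ⟨?_, ?_⟩, ?_, ?_⟩
  · refine (hp'.concat ?_ hby.symm).cons ?_
    · rw [Walk.support_mapLe_eq_support]
      exact fun h => hs b h hb
    · rw [Walk.support_concat, Walk.support_mapLe_eq_support]
      simp only [List.mem_append, List.mem_singleton, not_or]
      exact ⟨fun h => hs a h ha, hab⟩
  · intro t ht
    rw [Walk.support_cons, Walk.support_concat, Walk.support_mapLe_eq_support] at ht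
    simp only [List.mem_append, List.mem_cons, List.not_mem_nil, or_false] at ht
    rcases ht with h | h | h
    · exact Or.inl h
    · exact absurd ⟨t, rfl⟩ (hs _ h)
    · exact Or.inr h
  · simp
  · rw [Walk.penultimate_cons_of_not_nil, Walk.penultimate_concat]
    exact fun h => by simpa using Walk.length_eq_zero_iff.2 h

lemma SimpleGraph.IsAcyclic.eq_of_adj_of_reachable_innerGraph (hF : F.IsAcyclic) {a x x' : V}
    (ha : a ∈ Set.range c) (hx : F.Adj a x) (hx' : F.Adj a x') (hxc : x ∉ Set.range c)
    (h : (innerGraph F c).Reachable x x') : x = x' := by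
  obtain ⟨p, hp⟩ := h.exists_isPath
  have hs := notMem_of_mem_support_innerGraph p hxc
  have hp' : (Walk.cons hx (p.mapLe (innerGraph_le F c))).IsPath := by
    refine (hp.mapLe _).cons ?_
    rw [Walk.support_mapLe_eq_support]
    exact fun h => hs a h ha
  have := hF.eq_snd_of_adj_start hp' hx' (by simp)
  simpa using this.symm

/-- Positions on the cycle joined by an ear in `F`. -/
def EarIndex (F : SimpleGraph V) (c : ℕ → V) (L : ℕ) : Type :=
  {p : ℕ × ℕ // p.1 < p.2 ∧ p.2 < L ∧ ∃ q : F.Walk (c p.1) (c p.2), IsEar c q}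

instance : Finite (EarIndex F c L) := by
  refine Finite.of_injective
    (fun i : EarIndex F c L => ((⟨i.1.1, i.2.1.trans i.2.2.1⟩, ⟨i.1.2, i.2.2.1⟩) : Fin L × Fin L))
    fun i j h => ?_
  simp only [Prod.mk.injEq, Fin.mk.injEq] at h
  exact Subtype.ext (Prod.ext h.1 h.2)

namespace EarIndex

/-- The ear itself. -/
noncomputable def path (i : EarIndex F c L) : F.Walk (c i.1.1) (c i.1.2) := i.2.2.2.choose

lemma isEar (i : EarIndex F c L) : IsEar c i.path := i.2.2.2.choose_spec

open Classical in
/-- The component of `innerGraph F c` containing the inner vertices of an ear; an ear without inner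
vertices is its own class. -/
noncomputable def cls (i : EarIndex F c L) :
    (innerGraph F c).ConnectedComponent ⊕ EarIndex F c L :=
  if h : ∃ v ∈ i.path.support, v ∉ Set.range c then
    Sum.inl ((innerGraph F c).connectedComponentMk h.choose) else Sum.inr i

lemma cls_eq_inl {i : EarIndex F c L} {v : V} (hv : v ∈ i.path.support) (hv' : v ∉ Set.range c) :
    i.cls = Sum.inl ((innerGraph F c).connectedComponentMk v) := by
  have h : ∃ v ∈ i.path.support, v ∉ Set.range c := ⟨v, hv, hv'⟩
  rw [cls, dif_pos h]
  exact congrArg _ (ConnectedComponent.sound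
    (i.isEar.reachable h.choose_spec.1 hv h.choose_spec.2 hv'))

lemma exists_of_cls_eq_inl {i : EarIndex F c L} {K} (h : i.cls = Sum.inl K) :
    ∃ v ∈ i.path.support, v ∉ Set.range c ∧ (innerGraph F c).connectedComponentMk v = K := by
  by_cases h' : ∃ v ∈ i.path.support, v ∉ Set.range c
  · obtain ⟨v, hv, hv'⟩ := h'
    rw [cls_eq_inl hv hv', Sum.inl.injEq] at h
    exact ⟨v, hv, hv', h⟩
  · rw [cls, dif_neg h'] at h
    cases h

lemma eq_of_cls_eq_inr {i j : EarIndex F c L} (h : i.cls = Sum.inr j) : i = j := by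
  by_cases h' : ∃ v ∈ i.path.support, v ∉ Set.range c
  · obtain ⟨v, hv, hv'⟩ := h'
    rw [cls_eq_inl hv hv'] at h
    cases h
  · rw [cls, dif_neg h'] at h
    exact Sum.inr.inj h

lemma eq_of_mem_support (hc : CyclicParam G c L) {i j : EarIndex F c L}
    (h1 : c i.1.1 ∈ j.path.support) (h2 : c i.1.2 ∈ j.path.support) : i = j := by
  have hi := i.2.1
  have hi' := i.2.2.1
  have hj := j.2.1
  have hj' := j.2.2.1
  rcases j.isEar.ends _ h1 with h1 | h1 <;> rcases j.isEar.ends _ h2 with h2 | h2 <;>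
    replace h1 := hc.inj _ (by omega) _ (by omega) h1 <;>
    replace h2 := hc.inj _ (by omega) _ (by omega) h2
  · omega
  · exact Subtype.ext (Prod.ext h1 h2)
  · omega
  · omega

lemma notNil (hc : CyclicParam G c L) (i : EarIndex F c L) : ¬ i.path.Nil := by
  intro h
  have hi := i.2.1
  have hi' := i.2.2.1
  have := hc.inj _ (by omega) _ (by omega) h.eq
  omega

end EarIndex

/-- The system of all ears in `F`. -/
noncomputable def earSystem (hc : CyclicParam G c L) (hFG : F ≤ G)
    (hFc : ∀ e ∈ F.edgeSet, e ∉ cycleEdges c) :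
    EarSystem G c L (EarIndex F c L) ((innerGraph F c).ConnectedComponent ⊕ EarIndex F c L) where
  x i := i.1.1
  y i := i.1.2
  S i := {v | v ∈ i.path.support}
  E i := {e | e ∈ i.path.edges}
  w i := i.path.length
  cls i := i.cls
  x_lt i := i.2.1
  y_lt i := i.2.2.1
  ear i := {
    path := ⟨i.path.mapLe hFG, i.isEar.isPath.mapLe _, by simp, by simp, by simp⟩
    ends := i.isEar.ends
    edge := fun e he => hFc e (i.path.edges_subset_edgeSet he) }
  compat i j hij v hi hj := by
    by_contra h
    have hv : v ∉ Set.range c := fun ⟨t, ht⟩ => h ⟨t, ht.symm⟩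
    exact hij (by rw [EarIndex.cls_eq_inl hi hv, EarIndex.cls_eq_inl hj hv])
  ident T i hT h := by
    have h1 := h (show s(c i.1.1, i.path.snd) ∈ {e | e ∈ i.path.edges} from
      Walk.mk_start_snd_mem_edges (i.notNil hc))
    have h2 := h (show s(i.path.penultimate, c i.1.2) ∈ {e | e ∈ i.path.edges} from
      Walk.mk_penultimate_end_mem_edges (i.notNil hc))
    simp only [Set.mem_iUnion, exists_prop] at h1 h2
    obtain ⟨j, hj, h1⟩ := h1
    obtain ⟨j', hj', h2⟩ := h2
    by_cases hv : ∃ v ∈ i.path.support, v ∉ Set.range c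
    · obtain ⟨v, hv, hv'⟩ := hv
      have h3 := (i.isEar.snd ⟨_, rfl⟩ ⟨_, rfl⟩ hv hv').2
      have h4 := (i.isEar.penultimate ⟨_, rfl⟩ ⟨_, rfl⟩ hv hv').2
      have h5 := EarIndex.cls_eq_inl (j.path.snd_mem_support_of_mem_edges h1) h3
      have h6 := EarIndex.cls_eq_inl (j'.path.fst_mem_support_of_mem_edges h2) h4
      have h7 : j = j' := hT hj hj' (by
        refine h5.trans (Eq.trans ?_ h6.symm)
        exact congrArg _ (ConnectedComponent.sound (i.isEar.reachable
          (Walk.getVert_mem_support _ _) (Walk.getVert_mem_support _ _) h3 h4)))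
      subst h7
      rw [EarIndex.eq_of_mem_support hc (j.path.fst_mem_support_of_mem_edges h1)
        (j.path.snd_mem_support_of_mem_edges h2)]
      exact hj
    · push Not at hv
      obtain ⟨t, ht⟩ := hv i.path.snd (Walk.getVert_mem_support _ _)
      have h3 : i.path.snd = c i.1.2 := by
        have h4 := i.isEar.ends t (by rw [ht]; exact Walk.getVert_mem_support _ _)
        rw [ht] at h4
        refine h4.resolve_left fun h5 => ?_
        exact (i.path.adj_snd (i.notNil hc)).ne h5.symm
      rw [h3] at h1
      rw [EarIndex.eq_of_mem_support hc (j.path.fst_mem_support_of_mem_edges h1)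
        (j.path.snd_mem_support_of_mem_edges h1)]
      exact hj
  inj i j h1 h2 := Subtype.ext (Prod.ext h1 h2)

end Ears

section Rooted

variable {V : Type*} {F G : SimpleGraph V} {c : ℕ → V} {L : ℕ}

/-- Some edge of `F` joins `c t` to a vertex of `K` off the image of `c`. -/
def Attached (F : SimpleGraph V) (c : ℕ → V) (K : (innerGraph F c).ConnectedComponent) (t : ℕ) :
    Prop :=
  ∃ x ∉ Set.range c, F.Adj (c t) x ∧ (innerGraph F c).connectedComponentMk x = K

namespace EarIndex

lemma attached_of_cls {i : EarIndex F c L} {K} (h : i.cls = Sum.inl K) :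
    Attached F c K i.1.1 ∧ Attached F c K i.1.2 := by
  obtain ⟨v, hv, hv', rfl⟩ := exists_of_cls_eq_inl h
  obtain ⟨h1, h2⟩ := i.isEar.snd ⟨_, rfl⟩ ⟨_, rfl⟩ hv hv'
  obtain ⟨h3, h4⟩ := i.isEar.penultimate ⟨_, rfl⟩ ⟨_, rfl⟩ hv hv'
  exact ⟨⟨_, h2, h1, ConnectedComponent.sound
      (i.isEar.reachable (Walk.getVert_mem_support _ _) hv h2 hv')⟩,
    ⟨_, h4, h3, ConnectedComponent.sound
      (i.isEar.reachable (Walk.getVert_mem_support _ _) hv h4 hv')⟩⟩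

lemma exists_of_attached (hc : CyclicParam G c L) (hF : F.IsAcyclic) {s t : ℕ} (hst : s < t)
    (ht : t < L) {x y : V} (hx : x ∉ Set.range c) (hsx : F.Adj (c s) x) (hty : F.Adj (c t) y)
    (hxy : (innerGraph F c).Reachable x y) :
    ∃ i : EarIndex F c L, i.1 = (s, t) ∧
      i.cls = Sum.inl ((innerGraph F c).connectedComponentMk x) ∧ i.path.penultimate = y := by
  obtain ⟨q, hq, hq1, hq2⟩ := exists_isEar (b := c t) ⟨s, rfl⟩ ⟨t, rfl⟩
    (fun h => by have := hc.inj _ (by omega) _ ht h; omega) hx hsx hty hxy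
  let i : EarIndex F c L := ⟨(s, t), hst, ht, q, hq⟩
  have hi : i.path = q := hF.isPath_eq i.isEar.isPath hq.isPath
  exact ⟨i, rfl, cls_eq_inl (by rw [hi]; exact hq1) hx, by rw [hi]; exact hq2⟩

/-- The ears starting at the first position of their class. -/
def IsRooted (i : EarIndex F c L) : Prop := ∀ j : EarIndex F c L, j.cls = i.cls → i.1.1 ≤ j.1.1

open Classical in
lemma card_rooted_mul_le [Fintype (EarIndex F c L)] (hc : CyclicParam G c L) (hF : F.IsAcyclic)
    (k : (innerGraph F c).ConnectedComponent ⊕ EarIndex F c L) :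
    ((Finset.univ.filter fun i : EarIndex F c L => i.IsRooted).filter fun i => i.cls = k).card *
      (((Finset.univ.filter fun i : EarIndex F c L => i.IsRooted).filter
        fun i => i.cls = k).card + 1) ≤
      2 * (Finset.univ.filter fun i : EarIndex F c L => i.cls = k).card := by
  set A := (Finset.univ.filter fun i : EarIndex F c L => i.IsRooted).filter fun i => i.cls = k
    with hA
  set B := Finset.univ.filter fun i : EarIndex F c L => i.cls = k with hB
  have hAB : A ⊆ B := fun i hi => Finset.mem_filter.2 ⟨Finset.mem_univ _, (Finset.mem_filter.1 hi).2⟩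
  have memA : ∀ i, i ∈ A ↔ i.IsRooted ∧ i.cls = k := fun i => by simp [hA]
  have memB : ∀ i, i ∈ B ↔ i.cls = k := fun i => by simp [hB]
  rcases A.eq_empty_or_nonempty with h0 | ⟨i₀, hi₀⟩
  · simp [h0]
  rcases k with K | j
  · obtain ⟨r₀, k₀⟩ := (memA _).1 hi₀
    have hx : ∀ i ∈ A, i.1.1 = i₀.1.1 := fun i hi => by
      obtain ⟨r, k⟩ := (memA _).1 hi
      exact le_antisymm (r _ (k₀.trans k.symm)) (r₀ _ (k.trans k₀.symm))
    set Y := insert i₀.1.1 (A.image fun i => i.1.2) with hY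
    have hYc : Y.card = A.card + 1 := by
      rw [hY, Finset.card_insert_of_notMem, Finset.card_image_of_injOn]
      · intro i hi j hj h
        exact Subtype.ext (Prod.ext ((hx i hi).trans (hx j hj).symm) h)
      · intro h
        obtain ⟨i, hi, h⟩ := Finset.mem_image.1 h
        have h1 := i.2.1
        have h2 := hx i hi
        omega
    have hatt : ∀ t ∈ Y, t < L ∧ Attached F c K t := by
      intro t ht
      rcases Finset.mem_insert.1 ht with rfl | ht
      · exact ⟨i₀.2.1.trans i₀.2.2.1, (attached_of_cls k₀).1⟩
      · obtain ⟨i, hi, rfl⟩ := Finset.mem_image.1 ht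
        exact ⟨i.2.2.1, (attached_of_cls ((memA _).1 hi).2).2⟩
    have hex : ∀ s ∈ Y, ∀ t ∈ Y, s < t → ∃ i ∈ B, i.1 = (s, t) := by
      intro s hs t ht hst
      obtain ⟨x, hx, hsx, hxK⟩ := (hatt s hs).2
      obtain ⟨y, hy, hty, hyK⟩ := (hatt t ht).2
      obtain ⟨i, h1, h2, -⟩ := exists_of_attached hc hF hst (hatt t ht).1 hx hsx hty
        (ConnectedComponent.exact (hxK.trans hyK.symm))
      exact ⟨i, (memB _).2 (by rw [h2, hxK]), h1⟩
    have hsub : Y.offDiag ⊆ (B.image fun i => (i.1.1, i.1.2)) ∪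
        (B.image fun i => (i.1.2, i.1.1)) := by
      rintro ⟨s, t⟩ h
      obtain ⟨hs, ht, hst⟩ := Finset.mem_offDiag.1 h
      rcases lt_or_gt_of_ne hst with hst | hst
      · obtain ⟨i, hi, h⟩ := hex s hs t ht hst
        exact Finset.mem_union_left _ (Finset.mem_image.2 ⟨i, hi, h⟩)
      · obtain ⟨i, hi, h⟩ := hex t ht s hs hst
        exact Finset.mem_union_right _ (Finset.mem_image.2 ⟨i, hi, by rw [h]⟩)
    have h1 := (Finset.card_le_card hsub).trans (Finset.card_union_le _ _)
    have h2 := Finset.card_image_le (s := B) (f := fun i => (i.1.1, i.1.2))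
    have h3 := Finset.card_image_le (s := B) (f := fun i => (i.1.2, i.1.1))
    rw [Finset.offDiag_card, hYc, Nat.mul_add_one, Nat.add_sub_cancel, mul_comm] at h1
    omega
  · have h1 : A.card ≤ 1 := Finset.card_le_one.2 fun i hi i' hi' =>
      (eq_of_cls_eq_inr ((memA _).1 hi).2).trans (eq_of_cls_eq_inr ((memA _).1 hi').2).symm
    have h2 := Finset.card_le_card hAB
    calc A.card * (A.card + 1) ≤ A.card * 2 := Nat.mul_le_mul_left _ (by omega)
      _ ≤ _ := by omega

end EarIndex

/-- Each edge of `F` lies off the cycle, or is the last edge of a rooted ear, or is the first edge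
attaching its component. -/
lemma ncard_edgeSet_add_le [Finite V] (hc : CyclicParam G c L) (hF : F.IsAcyclic) :
    F.edgeSet.ncard + L ≤ Nat.card V + {i : EarIndex F c L | i.IsRooted}.ncard := by
  classical
  set C : Set (innerGraph F c).ConnectedComponent :=
    (innerGraph F c).connectedComponentMk '' (Set.range c)ᶜ with hC
  have hf : ∀ K, ∃ e : Sym2 V, ∀ t < L, Attached F c K t → (∀ s < L, Attached F c K s → t ≤ s) →
      ∀ x ∉ Set.range c, F.Adj (c t) x → (innerGraph F c).connectedComponentMk x = K →
        e = s(c t, x) := by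
    intro K
    by_cases h : ∃ t < L, Attached F c K t ∧ ∀ s < L, Attached F c K s → t ≤ s
    · obtain ⟨t, ht, ⟨x, hx, hx1, hx2⟩, hmin⟩ := h
      refine ⟨s(c t, x), fun t' ht' hat' hmin' x' hx' hx1' hx2' => ?_⟩
      obtain rfl : t = t' := le_antisymm (hmin _ ht' hat') (hmin' _ ht ⟨x, hx, hx1, hx2⟩)
      rw [hF.eq_of_adj_of_reachable_innerGraph ⟨t, rfl⟩ hx1 hx1' hx
        (ConnectedComponent.exact (hx2.trans hx2'.symm))]
    · exact ⟨s(c 0, c 0), fun t ht hat hmin => absurd ⟨t, ht, hat, hmin⟩ h⟩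
  choose f hf using hf
  set g : EarIndex F c L → Sym2 V := fun i => s(i.path.penultimate, c i.1.2) with hg
  have hsub : F.edgeSet ⊆ (innerGraph F c).edgeSet ∪ f '' C ∪ g '' {i | i.IsRooted} := by
    have hatt : ∀ t < L, ∀ x ∉ Set.range c, F.Adj (c t) x →
        s(c t, x) ∈ (innerGraph F c).edgeSet ∪ f '' C ∪ g '' {i | i.IsRooted} := by
      intro t ht x hx htx
      set K := (innerGraph F c).connectedComponentMk x with hK
      have hex : ∃ t, t < L ∧ Attached F c K t := ⟨t, ht, x, hx, htx, rfl⟩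
      have hm := Nat.find_spec hex
      have hmin : ∀ s < L, Attached F c K s → Nat.find hex ≤ s := fun s hs has =>
        Nat.find_min' hex ⟨hs, has⟩
      rcases (hmin t ht ⟨x, hx, htx, rfl⟩).eq_or_lt with h | h
      · exact Or.inl (Or.inr ⟨K, ⟨x, hx, rfl⟩,
          hf K t ht ⟨x, hx, htx, rfl⟩ (by rw [← h]; exact hmin) x hx htx rfl⟩)
      · obtain ⟨hm1, y, hy, hmy, hyK⟩ := hm
        obtain ⟨i, h1, h2, h3⟩ := EarIndex.exists_of_attached hc hF h ht hy hmy htx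
          (ConnectedComponent.exact hyK)
        refine Or.inr ⟨i, fun j hj => ?_, ?_⟩
        · rw [h2, hyK] at hj
          rw [h1]
          exact hmin _ (j.2.1.trans j.2.2.1) (EarIndex.attached_of_cls hj).1
        · simp only [hg]
          rw [h3, h1, Sym2.eq_swap]
    have hchord : ∀ s t, s < t → t < L → F.Adj (c s) (c t) →
        s(c s, c t) ∈ (innerGraph F c).edgeSet ∪ f '' C ∪ g '' {i | i.IsRooted} := by
      intro s t hst ht h
      have hq : IsEar c (Walk.cons h Walk.nil) := ⟨by simpa using h.ne, fun u hu => by simpa using hu⟩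
      let i : EarIndex F c L := ⟨(s, t), hst, ht, _, hq⟩
      have hi : i.path = Walk.cons h Walk.nil := hF.isPath_eq i.isEar.isPath hq.isPath
      have hcls : i.cls = Sum.inr i := by
        rw [EarIndex.cls, dif_neg]
        rintro ⟨v, hv, hv'⟩
        rw [hi] at hv
        rcases (by simpa using hv : v = c s ∨ v = c t) with rfl | rfl
        · exact hv' ⟨_, rfl⟩
        · exact hv' ⟨_, rfl⟩
      refine Or.inr ⟨i, fun j hj => ?_, ?_⟩
      · rw [EarIndex.eq_of_cls_eq_inr (hj.trans hcls)]
      · simp only [hg]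
        rw [hi]
        rfl
    have hlt : ∀ v ∈ Set.range c, ∃ t < L, c t = v := by
      rintro _ ⟨t, rfl⟩
      exact ⟨t % L, Nat.mod_lt _ (by have := hc.three_le; omega), hc.mod t⟩
    intro e
    induction e with | _ a b => ?_
    intro hab
    rw [mem_edgeSet] at hab
    by_cases ha : a ∈ Set.range c <;> by_cases hb : b ∈ Set.range c
    · obtain ⟨s, hs, rfl⟩ := hlt a ha
      obtain ⟨t, ht, rfl⟩ := hlt b hb
      rcases lt_trichotomy s t with h | rfl | h
      · exact hchord s t h ht hab
      · exact absurd rfl hab.ne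
      · rw [Sym2.eq_swap]
        exact hchord t s h hs hab.symm
    · obtain ⟨s, hs, rfl⟩ := hlt a ha
      exact hatt s hs b hb hab
    · obtain ⟨t, ht, rfl⟩ := hlt b hb
      rw [Sym2.eq_swap]
      exact hatt t ht a ha hab.symm
    · exact Or.inl (Or.inl ⟨hab, ha, hb⟩)
  have h1 := Set.ncard_le_ncard hsub
  have h2 := Set.ncard_union_le ((innerGraph F c).edgeSet ∪ f '' C) (g '' {i | i.IsRooted})
  have h3 := Set.ncard_union_le (innerGraph F c).edgeSet (f '' C)
  have h4 := Set.ncard_image_le (f := f) (Set.toFinite C)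
  have h5 := Set.ncard_image_le (f := g) (Set.toFinite {i | i.IsRooted})
  have h6 := (hF.anti (innerGraph_le F c)).ncard_edgeSet_add_card_le
  have h7 : C.ncard + L ≤ Nat.card (innerGraph F c).ConnectedComponent := by
    have hisol : ∀ {a b : V}, a ∈ Set.range c → (innerGraph F c).Reachable a b → a = b := by
      rintro a b ha ⟨p⟩
      cases p with
      | nil => rfl
      | cons h p => exact absurd ha h.2.1
    set D := (fun t : Fin L => (innerGraph F c).connectedComponentMk (c t)) '' Set.univ with hD
    have hD1 : D.ncard = L := by
      rw [hD, Set.ncard_image_of_injective, Set.ncard_univ, Nat.card_eq_fintype_card, Fintype.card_fin]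
      intro s t h
      exact Fin.ext (hc.inj _ s.2 _ t.2 (hisol ⟨_, rfl⟩ (ConnectedComponent.exact h)))
    have hdisj : Disjoint C D := by
      rw [Set.disjoint_left]
      rintro _ ⟨v, hv, rfl⟩ ⟨t, -, h⟩
      exact hv ((hisol ⟨_, rfl⟩ (ConnectedComponent.exact h)) ▸ ⟨_, rfl⟩)
    rw [← hD1, ← Set.ncard_union_eq hdisj, ← Set.ncard_univ]
    exact Set.ncard_le_ncard (Set.subset_univ _)
  omega

theorem forest_ncard_le [Fintype V] (hc : CyclicParam G c L) (hG : NoRepeatedCycleLengths G)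
    (hF : F.IsAcyclic) (hFG : F ≤ G) (hFc : ∀ e ∈ F.edgeSet, e ∉ cycleEdges c)
    (hn : (10 : ℝ) ^ 26 ≤ √(Fintype.card V)) :
    (F.edgeSet.ncard : ℝ) + L ≤ Fintype.card V + 1.005 * √(Fintype.card V) := by
  classical
  let _ := Fintype.ofFinite (EarIndex F c L)
  have h1 := (earSystem hc hFG hFc).card_le hc hG
    (Finset.univ.filter fun i : EarIndex F c L => i.IsRooted)
    (fun k => by convert EarIndex.card_rooted_mul_le hc hF k <;> rfl) hn
  have h2 := ncard_edgeSet_add_le hc hF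
  have h3 : {i : EarIndex F c L | i.IsRooted}.ncard =
      (Finset.univ.filter fun i : EarIndex F c L => i.IsRooted).card := by
    rw [← Set.ncard_coe_finset]
    simp
  rw [h3, Nat.card_eq_fintype_card] at h2
  have h4 : (F.edgeSet.ncard : ℝ) + L ≤ Fintype.card V +
    ((Finset.univ.filter fun i : EarIndex F c L => i.IsRooted).card : ℝ) := by exact_mod_cast h2
  linarith

end Rooted

section UpperBound

variable {V : Type*} {G : SimpleGraph V} {c : ℕ → V} {L : ℕ}

lemma SimpleGraph.Walk.IsTrail.ncard_edges {a b : V} {p : G.Walk a b} (hp : p.IsTrail) :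
    {e | e ∈ p.edges}.ncard = p.length := by
  classical
  rw [← Walk.length_edges, ← List.toFinset_card_of_nodup hp.edges_nodup, ← Set.ncard_coe_finset]
  congr 1
  ext e
  simp

lemma HasPath.ncard_edges {a b : V} {S : Set V} {E : Set (Sym2 V)} {m : ℕ}
    (h : HasPath G a b S E m) : E.ncard = m := by
  obtain ⟨p, hp, -, rfl, rfl⟩ := h
  exact hp.isTrail.ncard_edges

lemma HasCycle.ncard_edges {Z : Set (Sym2 V)} {m : ℕ} (h : HasCycle G Z m) : Z.ncard = m := by
  obtain ⟨u, p, hp, rfl, rfl⟩ := h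
  exact hp.isTrail.ncard_edges

lemma CyclicParam.le_ncard_cycleEdges [Finite V] (hc : CyclicParam G c L) :
    L ≤ (cycleEdges c).ncard + 1 := by
  have h3 := hc.three_le
  have h1 := (hc.arc (Nat.zero_le (L - 1)) (by omega)).ncard_edges
  have h2 : {e | ∃ t, 0 ≤ t ∧ t < L - 1 ∧ e = s(c t, c (t + 1))} ⊆ cycleEdges c := by
    rintro e ⟨t, -, -, rfl⟩
    exact ⟨t, rfl⟩
  have := Set.ncard_le_ncard h2
  omega

lemma CyclicParam.ncard_cycleEdges_le (hc : CyclicParam G c L) : (cycleEdges c).ncard ≤ L := by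
  have h1 : cycleEdges c = (fun t => s(c t, c (t + 1))) '' (Finset.range L : Set ℕ) := by
    ext e
    simp only [cycleEdges, Set.mem_image, Finset.coe_range, Set.mem_Iio, Set.mem_ofPred_eq]
    constructor
    · rintro ⟨t, rfl⟩
      have h3 := hc.three_le
      refine ⟨t % L, Nat.mod_lt _ (by omega), ?_⟩
      rw [hc.mod, ← hc.mod (t % L + 1), Nat.mod_add_mod, hc.mod]
    · rintro ⟨t, -, rfl⟩
      exact ⟨t, rfl⟩
  rw [h1]
  refine (Set.ncard_image_le (Finset.finite_toSet _)).trans ?_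
  rw [Set.ncard_coe_finset, Finset.card_range]

lemma SimpleGraph.Walk.IsCycle.exists_cyclicParam {u : V} {p : G.Walk u u} (hp : p.IsCycle) :
    ∃ c, CyclicParam G c p.length := by
  have h3 := hp.three_le_length
  refine ⟨fun i => p.getVert (i % p.length), h3, fun t => ?_, fun t => ?_, fun s hs t ht h => ?_⟩
  · have h1 : t % p.length < p.length := Nat.mod_lt _ (by omega)
    have h2 := p.adj_getVert_succ h1
    have h4 : p.getVert ((t + 1) % p.length) = p.getVert (t % p.length + 1) := by
      rcases (Nat.succ_le_of_lt h1).eq_or_lt with h | h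
      · rw [← Nat.mod_add_mod, show t % p.length + 1 = p.length from h, Nat.mod_self]
        simp
      · rw [← Nat.mod_add_mod, Nat.mod_eq_of_lt h]
    rw [h4]
    exact h2
  · rw [Nat.add_mod_right]
  · rw [Nat.mod_eq_of_lt hs, Nat.mod_eq_of_lt ht] at h
    exact hp.getVert_injOn' (by simp; omega) (by simp; omega) h

theorem CyclicParam.exists_ncard_le [Fintype V] (hc : CyclicParam G c L)
    (hG : NoRepeatedCycleLengths G) (hn : (10 : ℝ) ^ 26 ≤ √(Fintype.card V)) :
    ∃ k : ℕ, k + L ≤ G.edgeSet.ncard + 1 ∧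
      (G.edgeSet.ncard : ℝ) ≤ Fintype.card V + 1.005 * √(Fintype.card V) + 2 * √k + 1 := by
  classical
  set E₀ : Finset (Sym2 V) := (Set.toFinite (G.edgeSet \ cycleEdges c)).toFinset with hE₀
  have memE₀ : ∀ e, e ∈ E₀ ↔ e ∈ G.edgeSet ∧ e ∉ cycleEdges c := fun e => by simp [hE₀]
  have hcyc : cycleEdges c ⊆ G.edgeSet := by
    rintro e ⟨t, rfl⟩
    exact hc.adj t
  have hE₀c : E₀.card = (G.edgeSet \ cycleEdges c).ncard :=
    (Set.ncard_eq_toFinset_card _ _).symm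
  have hE := Set.ncard_sdiff_add_ncard_of_subset hcyc
  have hle := hc.ncard_cycleEdges_le
  have hge := hc.le_ncard_cycleEdges
  obtain ⟨X, hX, hXc, hXZ⟩ := exists_transversal E₀
    (E₀.powerset.filter fun Z => ∃ m, HasCycle G (Z : Set (Sym2 V)) m)
    (fun Z hZ => Finset.mem_powerset.1 (Finset.mem_filter.1 hZ).1)
    (fun Z hZ => by
      obtain ⟨m, u, p, hp, h1, h2⟩ := (Finset.mem_filter.1 hZ).2
      have h3 := hp.three_le_length
      have h4 : Z.card = p.length := by
        rw [← hp.isTrail.ncard_edges, h1, Set.ncard_coe_finset]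
      exact Finset.card_pos.1 (by omega))
    (fun Z hZ Z' hZ' h => by
      obtain ⟨m, hm⟩ := (Finset.mem_filter.1 hZ).2
      obtain ⟨m', hm'⟩ := (Finset.mem_filter.1 hZ').2
      have h1 := hm.ncard_edges
      have h2 := hm'.ncard_edges
      rw [Set.ncard_coe_finset] at h1 h2
      refine Finset.coe_injective (hG.eq hm ?_)
      rwa [← h1, h, h2])
  set F : SimpleGraph V := fromEdgeSet (E₀ \ X : Finset (Sym2 V)) with hF
  have hFe : F.edgeSet = (E₀ \ X : Finset (Sym2 V)) := by
    rw [hF, edgeSet_fromEdgeSet, sdiff_eq_left, Set.disjoint_left]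
    intro e he hd
    have := (memE₀ e).1 (Finset.sdiff_subset (Finset.mem_coe.1 he))
    exact G.not_isDiag_of_mem_edgeSet this.1 hd
  have hFG : F ≤ G := by
    rw [← edgeSet_subset_edgeSet, hFe]
    exact fun e he => ((memE₀ e).1 (Finset.sdiff_subset (Finset.mem_coe.1 he))).1
  have hFc : ∀ e ∈ F.edgeSet, e ∉ cycleEdges c := by
    rw [hFe]
    exact fun e he => ((memE₀ e).1 (Finset.sdiff_subset (Finset.mem_coe.1 he))).2
  have hFa : F.IsAcyclic := by
    intro u p hp
    have hsub : ∀ e ∈ p.edges, e ∈ E₀ \ X := fun e he => by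
      have := p.edges_subset_edgeSet he
      rw [hFe] at this
      exact this
    refine hXZ p.edges.toFinset (Finset.mem_filter.2 ⟨Finset.mem_powerset.2 fun e he => ?_, p.length,
      u, p.mapLe hFG, hp.mapLe _, by ext; simp, by simp⟩) (Finset.disjoint_left.2 fun e he => ?_)
    · exact Finset.sdiff_subset (hsub e (List.mem_toFinset.1 he))
    · exact (Finset.mem_sdiff.1 (hsub e (List.mem_toFinset.1 he))).2
  have h1 := forest_ncard_le hc hG hFa hFG hFc hn
  have h2 : F.edgeSet.ncard + X.card = E₀.card := by
    rw [hFe, Set.ncard_coe_finset, Finset.card_sdiff_add_card_eq_card hX]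
  refine ⟨E₀.card, by omega, ?_⟩
  have h3 : (F.edgeSet.ncard : ℝ) + X.card = E₀.card := by exact_mod_cast h2
  have h4 : (G.edgeSet.ncard : ℝ) ≤ E₀.card + L := by exact_mod_cast (by omega)
  linarith

end UpperBound

section Subdivision

lemma HasCycle.ncard_incident {V : Type*} [Finite V] {H : SimpleGraph V} {Z : Set (Sym2 V)} {m : ℕ}
    (h : HasCycle H Z m) (v : V) : {e | e ∈ Z ∧ v ∈ e}.ncard = 0 ∨ {e | e ∈ Z ∧ v ∈ e}.ncard = 2 := by
  obtain ⟨u, p, hp, rfl, -⟩ := h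
  by_cases hv : v ∈ p.support
  · right
    rw [← hp.ncard_neighborSet_toSubgraph_eq_two hv]
    have : {e | e ∈ {e | e ∈ p.edges} ∧ v ∈ e} = (fun w => s(v, w)) '' p.toSubgraph.neighborSet v := by
      ext e
      simp only [Set.mem_ofPred_eq, Set.mem_image, Subgraph.mem_neighborSet,
        Walk.adj_toSubgraph_iff_mem_edges]
      constructor
      · rintro ⟨he, hve⟩
        obtain ⟨w, rfl⟩ := hve
        exact ⟨w, he, rfl⟩
      · rintro ⟨w, hw, rfl⟩
        exact ⟨hw, Sym2.mem_mk_left _ _⟩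
    rw [this, Set.ncard_image_of_injective]
    intro w w' hw
    exact Sym2.congr_right.1 hw
  · left
    rw [Set.ncard_eq_zero, Set.eq_empty_iff_forall_notMem]
    rintro e ⟨he, hve⟩
    obtain ⟨w, rfl⟩ := hve
    exact hv (p.fst_mem_support_of_mem_edges he)

variable {C S : Type*}

/-- Core vertices together with the inner vertices of segments `σ` of length `ℓ σ`. -/
abbrev SubVertex (C : Type*) {S : Type*} (ℓ : S → ℕ) : Type _ := C ⊕ (Σ σ : S, Fin (ℓ σ - 1))

variable {ℓ : S → ℕ} {s t : S → C}

/-- The vertex at position `i` of the segment `σ`. -/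
def segVert (ℓ : S → ℕ) (s t : S → C) (σ : S) (i : ℕ) : SubVertex C ℓ :=
  if i = 0 then Sum.inl (s σ) else if h : i - 1 < ℓ σ - 1 then Sum.inr ⟨σ, ⟨i - 1, h⟩⟩
  else Sum.inl (t σ)

lemma segVert_eq_inl {σ : S} {i : ℕ} (hi : i ≤ ℓ σ) {v : C}
    (h : segVert ℓ s t σ i = Sum.inl v) : (i = 0 ∧ s σ = v) ∨ (i = ℓ σ ∧ t σ = v) := by
  unfold segVert at h
  split_ifs at h with h1 h2
  · exact Or.inl ⟨h1, Sum.inl.inj h⟩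
  · exact Or.inr ⟨by omega, Sum.inl.inj h⟩

lemma segVert_eq_inr {σ σ' : S} {i : ℕ} {k : Fin (ℓ σ' - 1)}
    (h : segVert ℓ s t σ i = Sum.inr ⟨σ', k⟩) : σ = σ' ∧ i = k + 1 := by
  unfold segVert at h
  split_ifs at h with h1 h2
  have h := Sum.inr.inj h
  cases h
  exact ⟨rfl, by simp; omega⟩

lemma segVert_inner {σ : S} {i : ℕ} (h0 : 0 < i) (hi : i < ℓ σ) :
    segVert ℓ s t σ i = Sum.inr ⟨σ, ⟨i - 1, by omega⟩⟩ := by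
  unfold segVert
  rw [if_neg (by omega), dif_pos]

lemma eq_of_segVert_eq {σ σ' : S} {i i' : ℕ} (h0 : 0 < i) (hi : i < ℓ σ)
    (h : segVert ℓ s t σ' i' = segVert ℓ s t σ i) : σ' = σ ∧ i' = i := by
  rw [segVert_inner h0 hi] at h
  have := segVert_eq_inr h
  refine ⟨this.1, this.2.trans ?_⟩
  simp
  omega

/-- The `i`-th edge of the segment `σ`. -/
def segEdge (ℓ : S → ℕ) (s t : S → C) (σ : S) (i : ℕ) : Sym2 (SubVertex C ℓ) :=
  s(segVert ℓ s t σ i, segVert ℓ s t σ (i + 1))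

lemma segEdge_inj (hℓ : ∀ σ, 3 ≤ ℓ σ) {σ σ' : S} {i i' : ℕ} (hi : i < ℓ σ) (hi' : i' < ℓ σ')
    (h : segEdge ℓ s t σ i = segEdge ℓ s t σ' i') : σ = σ' ∧ i = i' := by
  have h3 := hℓ σ
  rcases Sym2.eq_iff.1 h with ⟨h1, h2⟩ | ⟨h1, h2⟩
  · by_cases h0 : i = 0
    · have := eq_of_segVert_eq (by omega) (by omega) h2.symm
      exact ⟨this.1.symm, by omega⟩
    · have := eq_of_segVert_eq (by omega) hi h1.symm
      exact ⟨this.1.symm, by omega⟩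
  · exfalso
    by_cases h0 : i = 0
    · obtain ⟨rfl, h4⟩ := eq_of_segVert_eq (by omega) (by omega) h2.symm
      have := eq_of_segVert_eq (by omega) (by omega) h1
      omega
    · obtain ⟨rfl, h4⟩ := eq_of_segVert_eq (by omega) hi h1.symm
      by_cases h5 : i + 1 < ℓ σ'
      · have := eq_of_segVert_eq (by omega) h5 h2.symm
        omega
      · have := eq_of_segVert_eq (by omega) (by omega) h2
        omega

/-- The subdivision of the multigraph with edges `σ` from `s σ` to `t σ`. -/
def subdivision (ℓ : S → ℕ) (s t : S → C) : SimpleGraph (SubVertex C ℓ) :=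
  fromEdgeSet {e | ∃ σ, ∃ i < ℓ σ, e = segEdge ℓ s t σ i}

lemma edgeSet_subdivision (hℓ : ∀ σ, 3 ≤ ℓ σ) :
    (subdivision ℓ s t).edgeSet = {e | ∃ σ, ∃ i < ℓ σ, e = segEdge ℓ s t σ i} := by
  rw [subdivision, edgeSet_fromEdgeSet, sdiff_eq_left, Set.disjoint_left]
  rintro e ⟨σ, i, hi, rfl⟩ hd
  have h3 := hℓ σ
  have hd : segVert ℓ s t σ i = segVert ℓ s t σ (i + 1) := by simpa [segEdge] using hd
  by_cases h0 : i = 0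
  · have := eq_of_segVert_eq (by omega) (by omega) hd
    omega
  · have := eq_of_segVert_eq (by omega) hi hd.symm
    omega

/-- The edges of the segments in `T`. -/
def segEdges (ℓ : S → ℕ) (s t : S → C) (T : Finset S) : Set (Sym2 (SubVertex C ℓ)) :=
  {e | ∃ σ ∈ T, ∃ i < ℓ σ, e = segEdge ℓ s t σ i}

lemma ncard_segEdges (hℓ : ∀ σ, 3 ≤ ℓ σ) (T : Finset S) :
    (segEdges ℓ s t T).ncard = ∑ σ ∈ T, ℓ σ := by
  have h1 : segEdges ℓ s t T = (fun q : Σ _ : S, ℕ => segEdge ℓ s t q.1 q.2) ''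
      (T.sigma fun σ => Finset.range (ℓ σ) : Finset (Σ _ : S, ℕ)) := by
    ext e
    simp only [segEdges, Set.mem_ofPred_eq, Set.mem_image, Finset.mem_coe, Finset.mem_sigma,
      Finset.mem_range]
    constructor
    · rintro ⟨σ, hσ, i, hi, rfl⟩
      exact ⟨⟨σ, i⟩, ⟨hσ, hi⟩, rfl⟩
    · rintro ⟨⟨σ, i⟩, ⟨hσ, hi⟩, rfl⟩
      exact ⟨σ, hσ, i, hi, rfl⟩
  rw [h1, Set.InjOn.ncard_image, Set.ncard_coe_finset, Finset.card_sigma]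
  · simp
  · rintro ⟨σ, i⟩ hq ⟨σ', i'⟩ hq' h
    simp only [Finset.mem_coe, Finset.mem_sigma, Finset.mem_range] at hq hq'
    obtain ⟨rfl, rfl⟩ := segEdge_inj hℓ hq.2 hq'.2 h
    rfl

open Classical in
/-- A cycle of a subdivision consists of segments forming a 2-regular multigraph. -/
lemma HasCycle.exists_segments [Finite C] [Fintype S] (hℓ : ∀ σ, 3 ≤ ℓ σ)
    {Z : Set (Sym2 (SubVertex C ℓ))} {m : ℕ} (h : HasCycle (subdivision ℓ s t) Z m) :
    ∃ T : Finset S, Z = segEdges ℓ s t T ∧ m = ∑ σ ∈ T, ℓ σ ∧ T.Nonempty ∧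
      ∀ v, (T.filter fun σ => s σ = v).card + (T.filter fun σ => t σ = v).card = 0 ∨
        (T.filter fun σ => s σ = v).card + (T.filter fun σ => t σ = v).card = 2 := by
  have hinc := h.ncard_incident
  have hZ : ∀ e ∈ Z, ∃ σ, ∃ i < ℓ σ, e = segEdge ℓ s t σ i := by
    obtain ⟨u, p, hp, rfl, -⟩ := h
    intro e he
    have := p.edges_subset_edgeSet he
    rwa [edgeSet_subdivision hℓ] at this
  have hstep : ∀ σ i, i + 1 < ℓ σ → (segEdge ℓ s t σ i ∈ Z ↔ segEdge ℓ s t σ (i + 1) ∈ Z) := by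
    intro σ i hi
    have hsub : {e | e ∈ Z ∧ segVert ℓ s t σ (i + 1) ∈ e} ⊆
        {segEdge ℓ s t σ i, segEdge ℓ s t σ (i + 1)} := by
      rintro e ⟨he, hv⟩
      obtain ⟨σ', i', hi', rfl⟩ := hZ e he
      rcases Sym2.mem_iff.1 hv with hv | hv
      · obtain ⟨rfl, h2⟩ := eq_of_segVert_eq (by omega) hi hv.symm
        right
        rw [h2]
        rfl
      · obtain ⟨rfl, h2⟩ := eq_of_segVert_eq (by omega) hi hv.symm
        left
        rw [Nat.add_right_cancel h2]
    have key : ∀ e e', {e | e ∈ Z ∧ segVert ℓ s t σ (i + 1) ∈ e} ⊆ {e, e'} → e ∈ Z →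
        segVert ℓ s t σ (i + 1) ∈ e → e' ∈ Z := by
      intro e e' hsub he hv
      by_contra he'
      have h1 : {e | e ∈ Z ∧ segVert ℓ s t σ (i + 1) ∈ e} = {e} := by
        refine Set.Subset.antisymm (fun f hf => ?_) (by rintro _ rfl; exact ⟨he, hv⟩)
        rcases hsub hf with rfl | rfl
        · rfl
        · exact absurd hf.1 he'
      have h2 := hinc (segVert ℓ s t σ (i + 1))
      rw [h1, Set.ncard_singleton] at h2
      omega
    constructor
    · exact fun h => key _ _ hsub h (Sym2.mem_mk_right _ _)
    · exact fun h => key _ _ (by rwa [Set.pair_comm]) h (Sym2.mem_mk_left _ _)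
  have hall : ∀ σ i, i < ℓ σ → (segEdge ℓ s t σ i ∈ Z ↔ segEdge ℓ s t σ 0 ∈ Z) := by
    intro σ i
    induction i with
    | zero => simp
    | succ i ih => exact fun hi => (hstep σ i hi).symm.trans (ih (by omega))
  set T : Finset S := Finset.univ.filter fun σ => segEdge ℓ s t σ 0 ∈ Z with hT
  have memT : ∀ σ, σ ∈ T ↔ segEdge ℓ s t σ 0 ∈ Z := fun σ => by simp [hT]
  have hZT : Z = segEdges ℓ s t T := by
    ext e
    constructor
    · intro he
      obtain ⟨σ, i, hi, rfl⟩ := hZ e he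
      exact ⟨σ, (memT σ).2 ((hall σ i hi).1 he), i, hi, rfl⟩
    · rintro ⟨σ, hσ, i, hi, rfl⟩
      exact (hall σ i hi).2 ((memT σ).1 hσ)
  have hm : m = ∑ σ ∈ T, ℓ σ := by
    rw [← h.ncard_edges, hZT, ncard_segEdges hℓ]
  refine ⟨T, hZT, hm, ?_, fun v => ?_⟩
  · obtain ⟨u, p, hp, -, rfl⟩ := h
    have := hp.three_le_length
    by_contra hne
    rw [Finset.not_nonempty_iff_eq_empty.1 hne, Finset.sum_empty] at hm
    omega
  · have h1 : {e | e ∈ Z ∧ Sum.inl v ∈ e} =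
        (fun σ => segEdge ℓ s t σ 0) '' (T.filter fun σ => s σ = v : Finset S) ∪
        (fun σ => segEdge ℓ s t σ (ℓ σ - 1)) '' (T.filter fun σ => t σ = v : Finset S) := by
      ext e
      simp only [Set.mem_ofPred_eq, Set.mem_union, Set.mem_image, Finset.mem_coe, Finset.mem_filter]
      constructor
      · rintro ⟨he, hv⟩
        rw [hZT] at he
        obtain ⟨σ, hσ, i, hi, rfl⟩ := he
        rcases Sym2.mem_iff.1 hv with hv | hv
        · rcases segVert_eq_inl hi.le hv.symm with ⟨rfl, h1⟩ | ⟨h1, -⟩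
          · exact Or.inl ⟨σ, ⟨hσ, h1⟩, rfl⟩
          · omega
        · rcases segVert_eq_inl hi hv.symm with ⟨h1, -⟩ | ⟨h1, h2⟩
          · omega
          · exact Or.inr ⟨σ, ⟨hσ, h2⟩, by rw [← h1]; rfl⟩
      · rintro (⟨σ, ⟨hσ, rfl⟩, rfl⟩ | ⟨σ, ⟨hσ, rfl⟩, rfl⟩)
        · refine ⟨(memT σ).1 hσ, Sym2.mem_iff.2 (Or.inl ?_)⟩
          simp [segVert]
        · have h3 := hℓ σ
          refine ⟨(hall σ _ (by omega)).2 ((memT σ).1 hσ), Sym2.mem_iff.2 (Or.inr ?_)⟩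
          rw [segVert, if_neg (by omega), dif_neg (by omega)]
    have h2 := hinc (Sum.inl v)
    rw [h1, Set.ncard_union_eq, Set.InjOn.ncard_image, Set.InjOn.ncard_image,
      Set.ncard_coe_finset, Set.ncard_coe_finset] at h2
    · exact h2
    · intro σ _ σ' _ h
      have h3 := hℓ σ
      have h3' := hℓ σ'
      exact (segEdge_inj hℓ (by omega) (by omega) h).1
    · intro σ _ σ' _ h
      have h3 := hℓ σ
      have h3' := hℓ σ'
      exact (segEdge_inj hℓ (by omega) (by omega) h).1
    · rw [Set.disjoint_left]
      rintro _ ⟨σ, -, rfl⟩ ⟨σ', -, h⟩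
      have h3 := hℓ σ
      have h3' := hℓ σ'
      have := (segEdge_inj hℓ (by omega) (by omega) h).2
      omega

end Subdivision

section Construction

variable {p D : ℕ}

/-- Segments: loops at a hub and, for each gadget, two segments from the hub to a vertex `A`, two
from the hub to a vertex `B`, and one from `A` to `B`. -/
abbrev GadgetSeg (p : ℕ) : Type := (Fin (10 * p - 3) ⊕ Bool) ⊕ (Fin (2 * p) × Fin 5)

/-- The hub is `none`, the vertices `A` and `B` of a gadget are the other elements. -/
abbrev GadgetCore (p : ℕ) : Type := Option (Fin (2 * p) × Bool)

/-- Lengths of the segments. -/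
def gadgetLen (p D : ℕ) : GadgetSeg p → ℕ
  | .inl (.inl i) => i + 3
  | .inl (.inr false) => 12 * p
  | .inl (.inr true) => D
  | .inr (j, k) => ![3 * p, 7 * p + j, 5 * p, 9 * p + 1 + j, 4 * p + 1 + j] k

/-- First endpoints of the segments. -/
def gadgetSrc (p : ℕ) : GadgetSeg p → GadgetCore p
  | .inl _ => none
  | .inr (j, k) => if k = 4 then some (j, false) else none

/-- Second endpoints of the segments. -/
def gadgetTgt (p : ℕ) : GadgetSeg p → GadgetCore p
  | .inl _ => none
  | .inr (j, k) => if k < 2 then some (j, false) else some (j, true)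

lemma three_le_gadgetLen (hp : 1 ≤ p) (hD : 26 * p ≤ D) (σ : GadgetSeg p) :
    3 ≤ gadgetLen p D σ := by
  rcases σ with (i | b) | ⟨j, k⟩
  · simp [gadgetLen]
  · cases b <;> simp only [gadgetLen] <;> omega
  · fin_cases k <;> simp [gadgetLen] <;> omega

/-- The edge sets of the cycles of a gadget. -/
def gadgetCycles : Finset (Finset (Fin 5)) :=
  {{0, 1}, {2, 3}, {0, 2, 4}, {0, 3, 4}, {1, 2, 4}, {1, 3, 4}}

lemma gadget_cases : ∀ K : Finset (Fin 5), K.Nonempty →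
    ((K.filter fun k => k = 4).card + (K.filter fun k => k < 2).card = 0 ∨
      (K.filter fun k => k = 4).card + (K.filter fun k => k < 2).card = 2) →
    ((K.filter fun k => ¬ k < 2).card = 0 ∨ (K.filter fun k => ¬ k < 2).card = 2) →
    2 ≤ (K.filter fun k => k ≠ 4).card ∧
      ((K.filter fun k => k ≠ 4).card ≤ 2 → K ∈ gadgetCycles) := by
  decide

/-- The segments of a gadget. -/
def gadgetEmb (j : Fin (2 * p)) : Fin 5 ↪ GadgetSeg p :=
  ⟨fun k => Sum.inr (j, k), fun k k' h => by simpa using h⟩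

lemma gadgetEmb_apply (j : Fin (2 * p)) (k : Fin 5) : gadgetEmb j k = Sum.inr (j, k) := rfl

open Classical in
lemma gadget_segments {T : Finset (GadgetSeg p)} (hT : T.Nonempty)
    (h : ∀ v, (T.filter fun σ => gadgetSrc p σ = v).card +
        (T.filter fun σ => gadgetTgt p σ = v).card = 0 ∨
      (T.filter fun σ => gadgetSrc p σ = v).card +
        (T.filter fun σ => gadgetTgt p σ = v).card = 2) :
    (∃ i, T = {Sum.inl i}) ∨ ∃ j, ∃ K ∈ gadgetCycles, T = K.map (gadgetEmb j) := by
  set K : Fin (2 * p) → Finset (Fin 5) := fun j => Finset.univ.filter fun k => Sum.inr (j, k) ∈ T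
    with hK
  have memK : ∀ j k, k ∈ K j ↔ Sum.inr (j, k) ∈ T := fun j k => by simp [hK]
  have hcard : ∀ (f : GadgetSeg p → GadgetCore p) (v : GadgetCore p) (j : Fin (2 * p))
      (P : Fin 5 → Prop) [DecidablePred P], (∀ i, f (Sum.inl i) ≠ v) →
      (∀ j' k, f (Sum.inr (j', k)) = v ↔ j' = j ∧ P k) →
      (T.filter fun σ => f σ = v).card = ((K j).filter P).card := by
    intro f v j P _ h1 h2
    rw [← Finset.card_map (gadgetEmb j)]
    congr 1
    ext σ
    rw [Finset.mem_filter, Finset.mem_map]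
    rcases σ with i | ⟨j', k⟩
    · simp [h1, gadgetEmb_apply]
    · rw [h2]
      simp only [gadgetEmb_apply, Finset.mem_filter, memK, Sum.inr.injEq, Prod.mk.injEq]
      constructor
      · rintro ⟨h3, rfl, h4⟩
        exact ⟨k, ⟨h3, h4⟩, rfl, rfl⟩
      · rintro ⟨k, ⟨h3, h4⟩, rfl, rfl⟩
        exact ⟨h3, rfl, h4⟩
  have hA1 : ∀ j, (T.filter fun σ => gadgetSrc p σ = some (j, false)).card =
      ((K j).filter fun k => k = 4).card := fun j => by
    refine hcard _ _ _ _ (by simp [gadgetSrc]) fun j' k => ?_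
    simp only [gadgetSrc]
    split_ifs with hk <;> simp [hk]
  have hA2 : ∀ j, (T.filter fun σ => gadgetTgt p σ = some (j, false)).card =
      ((K j).filter fun k => k < 2).card := fun j => by
    refine hcard _ _ _ _ (by simp [gadgetTgt]) fun j' k => ?_
    simp only [gadgetTgt]
    split_ifs with hk <;> simp [hk]
  have hB1 : ∀ j, (T.filter fun σ => gadgetSrc p σ = some (j, true)).card = 0 := fun j => by
    rw [Finset.card_eq_zero, Finset.filter_eq_empty_iff]
    rintro (i | ⟨j', k⟩) -
    · simp [gadgetSrc]
    · simp only [gadgetSrc]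
      split_ifs <;> simp
  have hB2 : ∀ j, (T.filter fun σ => gadgetTgt p σ = some (j, true)).card =
      ((K j).filter fun k => ¬ k < 2).card := fun j => by
    refine hcard _ _ _ _ (by simp [gadgetTgt]) fun j' k => ?_
    simp only [gadgetTgt]
    split_ifs with hk <;> simp [hk]
  have hgad : ∀ j, (K j).Nonempty → 2 ≤ ((K j).filter fun k => k ≠ 4).card ∧
      (((K j).filter fun k => k ≠ 4).card ≤ 2 → K j ∈ gadgetCycles) := fun j hj => by
    have h1 := h (some (j, false))
    have h2 := h (some (j, true))
    rw [hA1, hA2] at h1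
    rw [hB1, hB2, zero_add] at h2
    exact gadget_cases _ hj h1 h2
  have hhub : (T.filter fun σ => gadgetSrc p σ = none).card +
      (T.filter fun σ => gadgetTgt p σ = none).card ≤ 2 := by
    rcases h none with h | h <;> omega
  have hsub : ∀ j, ((K j).filter fun k => k ≠ 4).map (gadgetEmb j) ⊆
      T.filter fun σ => gadgetSrc p σ = none := by
    intro j σ hσ
    obtain ⟨k, hk, rfl⟩ := Finset.mem_map.1 hσ
    rw [Finset.mem_filter, memK] at hk
    rw [Finset.mem_filter]
    exact ⟨hk.1, by simp [gadgetEmb_apply, gadgetSrc, hk.2]⟩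
  have hloop : ∀ i, Sum.inl i ∈ T → T = {Sum.inl i} := by
    intro i hi
    have h1 : 1 ≤ (T.filter fun σ => gadgetTgt p σ = none).card :=
      Finset.card_pos.2 ⟨Sum.inl i, Finset.mem_filter.2 ⟨hi, rfl⟩⟩
    refine Finset.eq_singleton_iff_unique_mem.2 ⟨hi, fun σ hσ => ?_⟩
    have h2 : (T.filter fun σ => gadgetSrc p σ = none).card ≤ 1 := by omega
    have h3 : Sum.inl i ∈ T.filter fun σ => gadgetSrc p σ = none := Finset.mem_filter.2 ⟨hi, rfl⟩
    rcases σ with i' | ⟨j, k⟩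
    · exact Finset.card_le_one.1 h2 _ (Finset.mem_filter.2 ⟨hσ, rfl⟩) _ h3
    · have h4 := (hgad j ⟨k, (memK _ _).2 hσ⟩).1
      have h5 := Finset.card_le_card (hsub j)
      rw [Finset.card_map] at h5
      omega
  obtain ⟨σ, hσ⟩ := hT
  rcases σ with i | ⟨j, k⟩
  · exact Or.inl ⟨i, hloop i hσ⟩
  · right
    have hj := hgad j ⟨k, (memK _ _).2 hσ⟩
    have h5 := Finset.card_le_card (hsub j)
    rw [Finset.card_map] at h5
    refine ⟨j, K j, hj.2 (by omega), ?_⟩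
    ext τ
    rcases τ with i | ⟨j', k'⟩
    · refine ⟨fun hi => ?_, by simp [gadgetEmb_apply]⟩
      rw [hloop i hi] at hσ
      simp at hσ
    · constructor
      · intro hτ
        have hj' := (hgad j' ⟨k', (memK _ _).2 hτ⟩).1
        by_cases hjj : j' = j
        · subst hjj
          exact Finset.mem_map.2 ⟨k', (memK _ _).2 hτ, rfl⟩
        · exfalso
          have h6 := Finset.card_le_card (Finset.union_subset (hsub j) (hsub j'))
          rw [Finset.card_union_of_disjoint, Finset.card_map, Finset.card_map] at h6
          · omega
          · rw [Finset.disjoint_left]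
            intro τ h1 h2
            obtain ⟨k1, -, rfl⟩ := Finset.mem_map.1 h1
            obtain ⟨k2, -, h3⟩ := Finset.mem_map.1 h2
            simp only [gadgetEmb_apply, Sum.inr.injEq, Prod.mk.injEq] at h3
            exact hjj h3.1
      · intro hτ
        obtain ⟨k1, hk1, h3⟩ := Finset.mem_map.1 hτ
        rw [← h3]
        exact (memK _ _).1 hk1

open Classical in
lemma gadget_segments_eq (hp : 1 ≤ p) (hD : 26 * p ≤ D) {T T' : Finset (GadgetSeg p)}
    (hT : (∃ i, T = {Sum.inl i}) ∨ ∃ j, ∃ K ∈ gadgetCycles,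
      T = K.map (gadgetEmb j))
    (hT' : (∃ i, T' = {Sum.inl i}) ∨ ∃ j, ∃ K ∈ gadgetCycles,
      T' = K.map (gadgetEmb j))
    (h : ∑ σ ∈ T, gadgetLen p D σ = ∑ σ ∈ T', gadgetLen p D σ) : T = T' := by
  have hK : ∀ (j : Fin (2 * p)), ∀ K ∈ gadgetCycles,
      (K = {0, 1} ∧ ∑ k ∈ K, gadgetLen p D (Sum.inr (j, k)) = 10 * p + j) ∨
      (K = {2, 3} ∧ ∑ k ∈ K, gadgetLen p D (Sum.inr (j, k)) = 14 * p + 1 + j) ∨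
      (K = {0, 2, 4} ∧ ∑ k ∈ K, gadgetLen p D (Sum.inr (j, k)) = 12 * p + 1 + j) ∨
      (K = {0, 3, 4} ∧ ∑ k ∈ K, gadgetLen p D (Sum.inr (j, k)) = 16 * p + 2 + 2 * j) ∨
      (K = {1, 2, 4} ∧ ∑ k ∈ K, gadgetLen p D (Sum.inr (j, k)) = 16 * p + 1 + 2 * j) ∨
      (K = {1, 3, 4} ∧ ∑ k ∈ K, gadgetLen p D (Sum.inr (j, k)) = 20 * p + 2 + 3 * j) := by
    intro j K hK
    simp only [gadgetCycles, Finset.mem_insert, Finset.mem_singleton] at hK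
    rcases hK with rfl | rfl | rfl | rfl | rfl | rfl
    · exact Or.inl ⟨rfl, by simp [gadgetLen]; omega⟩
    · exact Or.inr (Or.inl ⟨rfl, by simp [gadgetLen]; omega⟩)
    · exact Or.inr (Or.inr (Or.inl ⟨rfl, by simp [gadgetLen]; omega⟩))
    · exact Or.inr (Or.inr (Or.inr (Or.inl ⟨rfl, by simp [gadgetLen]; omega⟩)))
    · exact Or.inr (Or.inr (Or.inr (Or.inr (Or.inl ⟨rfl, by simp [gadgetLen]; omega⟩))))
    · exact Or.inr (Or.inr (Or.inr (Or.inr (Or.inr ⟨rfl, by simp [gadgetLen]; omega⟩))))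
  have hL : ∀ i, (∃ i' : Fin (10 * p - 3), i = Sum.inl i' ∧ gadgetLen p D (Sum.inl i) = i' + 3) ∨
      (i = Sum.inr false ∧ gadgetLen p D (Sum.inl i) = 12 * p) ∨
      (i = Sum.inr true ∧ gadgetLen p D (Sum.inl i) = D) := by
    rintro (i | b)
    · exact Or.inl ⟨i, rfl, rfl⟩
    · cases b
      · exact Or.inr (Or.inl ⟨rfl, rfl⟩)
      · exact Or.inr (Or.inr ⟨rfl, rfl⟩)
  have hmix : ∀ i (j : Fin (2 * p)), ∀ K ∈ gadgetCycles, gadgetLen p D (Sum.inl i) ≠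
      ∑ k ∈ K, gadgetLen p D (Sum.inr (j, k)) := by
    intro i j K hKc
    have hj := j.2
    have h1 := hK j K hKc
    rcases hL i with ⟨i', -, h2⟩ | ⟨-, h2⟩ | ⟨-, h2⟩ <;> omega
  rcases hT with ⟨i, rfl⟩ | ⟨j, K, hKc, rfl⟩ <;> rcases hT' with ⟨i', rfl⟩ | ⟨j', K', hKc', rfl⟩
  · rw [Finset.sum_singleton, Finset.sum_singleton] at h
    suffices i = i' by rw [this]
    rcases hL i with ⟨k, rfl, h2⟩ | ⟨rfl, h2⟩ | ⟨rfl, h2⟩ <;>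
      rcases hL i' with ⟨k', rfl, h2'⟩ | ⟨rfl, h2'⟩ | ⟨rfl, h2'⟩ <;>
      first | rfl | (exfalso; omega) | (obtain rfl : k = k' := Fin.ext (by omega); rfl)
  · rw [Finset.sum_singleton, Finset.sum_map] at h
    exact absurd h (hmix _ _ _ hKc')
  · rw [Finset.sum_singleton, Finset.sum_map] at h
    exact absurd h.symm (hmix _ _ _ hKc)
  · rw [Finset.sum_map, Finset.sum_map] at h
    change ∑ k ∈ K, gadgetLen p D (Sum.inr (j, k)) =
      ∑ k ∈ K', gadgetLen p D (Sum.inr (j', k)) at h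
    have hj := j.2
    have hj' := j'.2
    suffices j = j' ∧ K = K' by rw [this.1, this.2]
    rw [Fin.ext_iff]
    rcases hK j K hKc with ⟨rfl, h1⟩ | ⟨rfl, h1⟩ | ⟨rfl, h1⟩ | ⟨rfl, h1⟩ | ⟨rfl, h1⟩ | ⟨rfl, h1⟩ <;>
      rcases hK j' K' hKc' with ⟨rfl, h2⟩ | ⟨rfl, h2⟩ | ⟨rfl, h2⟩ | ⟨rfl, h2⟩ | ⟨rfl, h2⟩ | ⟨rfl, h2⟩ <;>
      first | exact ⟨by omega, rfl⟩ | (exfalso; omega)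

/-- A graph without repeated cycle lengths and with many edges. -/
def gadgetGraph (p D : ℕ) : SimpleGraph (SubVertex (GadgetCore p) (gadgetLen p D)) :=
  subdivision (gadgetLen p D) (gadgetSrc p) (gadgetTgt p)

lemma noRepeatedCycleLengths_gadgetGraph (hp : 1 ≤ p) (hD : 26 * p ≤ D) :
    NoRepeatedCycleLengths (gadgetGraph p D) := by
  have hℓ := three_le_gadgetLen hp hD
  intro u v c₁ c₂ h₁ h₂ h
  obtain ⟨T, hT, hm, hne, hdeg⟩ := HasCycle.exists_segments hℓ ⟨u, c₁, h₁, rfl, rfl⟩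
  obtain ⟨T', hT', hm', hne', hdeg'⟩ := HasCycle.exists_segments hℓ ⟨v, c₂, h₂, rfl, rfl⟩
  have h3 : T = T' := gadget_segments_eq hp hD (gadget_segments hne (by convert hdeg))
    (gadget_segments hne' (by convert hdeg')) (hm.symm.trans (h.trans hm'))
  subst h3
  exact hT.trans hT'.symm

lemma sum_gadgetLen (p D : ℕ) (hp : 1 ≤ p) :
    ∑ σ, gadgetLen p D σ + 3 = 112 * p ^ 2 + 8 * p + D := by
  have h1 : ∀ m, 2 * ∑ i ∈ Finset.range m, (i + 3) = m * (m + 5) := by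
    intro m
    induction m with
    | zero => simp
    | succ m ih => rw [Finset.sum_range_succ, mul_add, ih]; ring
  have h2 : ∀ m, 2 * ∑ j ∈ Finset.range m, (28 * p + 2 + 3 * j) = m * (56 * p + 1 + 3 * m) := by
    intro m
    induction m with
    | zero => simp
    | succ m ih => rw [Finset.sum_range_succ, mul_add, ih]; ring
  have h3 : ∀ j : Fin (2 * p), ∑ k, gadgetLen p D (Sum.inr (j, k)) = 28 * p + 2 + 3 * j := by
    intro j
    rw [Fin.sum_univ_five]
    simp [gadgetLen]
    omega
  have h4 : ∑ i : Fin (10 * p - 3), gadgetLen p D (Sum.inl (Sum.inl i)) =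
      ∑ i ∈ Finset.range (10 * p - 3), (i + 3) := by
    rw [← Fin.sum_univ_eq_sum_range]
    rfl
  rw [Fintype.sum_sum_type, Fintype.sum_sum_type, Fintype.sum_bool, Fintype.sum_prod_type,
    Finset.sum_congr rfl fun j _ => h3 j, Fin.sum_univ_eq_sum_range (fun j => 28 * p + 2 + 3 * j),
    h4]
  have h5 := h1 (10 * p - 3)
  have h6 := h2 (2 * p)
  obtain ⟨q, rfl⟩ : ∃ q, p = q + 1 := ⟨p - 1, by omega⟩
  simp only [gadgetLen]
  rw [show 10 * (q + 1) - 3 = 10 * q + 7 by omega] at h5 ⊢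
  nlinarith

lemma card_gadget (hp : 1 ≤ p) (hD : 26 * p ≤ D) :
    Fintype.card (SubVertex (GadgetCore p) (gadgetLen p D)) + 16 * p = ∑ σ, gadgetLen p D σ + 2 := by
  have h1 : ∑ σ, (gadgetLen p D σ - 1) + Fintype.card (GadgetSeg p) = ∑ σ, gadgetLen p D σ := by
    rw [← Finset.card_univ, Finset.card_eq_sum_ones, ← Finset.sum_add_distrib]
    refine Finset.sum_congr rfl fun σ _ => ?_
    have := three_le_gadgetLen hp hD σ
    omega
  have h2 : Fintype.card (GadgetSeg p) = 20 * p - 1 := by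
    simp
    omega
  have h3 : Fintype.card (GadgetCore p) = 4 * p + 1 := by
    simp
    omega
  have h4 : Fintype.card (SubVertex (GadgetCore p) (gadgetLen p D)) =
      Fintype.card (GadgetCore p) + ∑ σ, (gadgetLen p D σ - 1) := by
    rw [Fintype.card_sum, Fintype.card_sigma]
    simp
  omega

lemma ncard_edgeSet_gadgetGraph (hp : 1 ≤ p) (hD : 26 * p ≤ D) :
    (gadgetGraph p D).edgeSet.ncard = ∑ σ, gadgetLen p D σ := by
  have hℓ := three_le_gadgetLen hp hD
  rw [← ncard_segEdges (s := gadgetSrc p) (t := gadgetTgt p) hℓ, gadgetGraph,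
    edgeSet_subdivision hℓ]
  simp [segEdges]

lemma NoRepeatedCycleLengths.of_iso {V W : Type*} {G : SimpleGraph V} {H : SimpleGraph W}
    (f : G ≃g H) (hG : NoRepeatedCycleLengths G) : NoRepeatedCycleLengths H := by
  intro u v c₁ c₂ h₁ h₂ h
  have h1 := hG _ _ (c₁.map f.symm.toHom) (c₂.map f.symm.toHom)
    (h₁.map f.symm.injective) (h₂.map f.symm.injective) (by simpa using h)
  have hinj : Function.Injective (Sym2.map f.symm.toHom) := Sym2.map.injective f.symm.injective
  ext e
  have h2 := Set.ext_iff.1 h1 (Sym2.map f.symm.toHom e)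
  simp only [Set.mem_ofPred_eq, Walk.edges_map, List.mem_map_of_injective hinj] at h2
  exact h2

theorem exists_noRepeatedCycleLengths {n p : ℕ} (hp : 1 ≤ p) (hn : 112 * p ^ 2 + 18 * p ≤ n) :
    ∃ H : SimpleGraph (Fin n), NoRepeatedCycleLengths H ∧ n + 16 * p = H.edgeSet.ncard + 2 := by
  obtain ⟨D, hD⟩ : ∃ D, 112 * p ^ 2 + D = n + 8 * p + 1 := ⟨n + 8 * p + 1 - 112 * p ^ 2, by omega⟩
  have hD' : 26 * p ≤ D := by omega
  have h1 := card_gadget hp hD'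
  have h2 := sum_gadgetLen p D hp
  have h3 : Fintype.card (SubVertex (GadgetCore p) (gadgetLen p D)) = n := by omega
  let f := Iso.map (Fintype.equivFinOfCardEq h3) (gadgetGraph p D)
  refine ⟨_, (noRepeatedCycleLengths_gadgetGraph hp hD').of_iso f, ?_⟩
  have h5 := Nat.card_congr f.mapEdgeSet
  rw [Nat.card_coe_set_eq, Nat.card_coe_set_eq, ncard_edgeSet_gadgetGraph hp hD'] at h5
  omega

end Construction

/-- For all sufficiently large `n`, any simple graph on `n` vertices with no
repeated cycle lengths and with the maximum possible number of edges among all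
such graphs has all its cycles of length at most `(15/16) * n`. -/
theorem stmt_0 :
    ∃ N : ℕ, ∀ n : ℕ, N ≤ n →
      ∀ G : SimpleGraph (Fin n),
        NoRepeatedCycleLengths G →
        (∀ H : SimpleGraph (Fin n), NoRepeatedCycleLengths H →
          H.edgeSet.ncard ≤ G.edgeSet.ncard) →
        ∀ (u : Fin n) (c : G.Walk u u), c.IsCycle →
          (c.length : ℝ) ≤ (15 / 16 : ℝ) * n := by
  refine ⟨10 ^ 52, fun n hn G hG hmax u c hc => ?_⟩
  set r : ℝ := √n with hr
  have hr2 : r ^ 2 = n := Real.sq_sqrt (Nat.cast_nonneg n)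
  have hr26 : (10 : ℝ) ^ 26 ≤ r := by
    refine Real.le_sqrt_of_sq_le ?_
    have : ((10 ^ 52 : ℕ) : ℝ) ≤ n := Nat.cast_le.2 hn
    push_cast at this
    linarith
  have hM : (n : ℝ) + 1.51 * r ≤ G.edgeSet.ncard := by
    obtain ⟨p, hp⟩ : ∃ p : ℕ, p = ⌊0.0944 * r⌋₊ := ⟨_, rfl⟩
    have h1 : (p : ℝ) ≤ 0.0944 * r := hp ▸ Nat.floor_le (by positivity)
    have h2 : 0.0944 * r < p + 1 := hp ▸ Nat.lt_floor_add_one _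
    have h3 : 1 ≤ p := by
      have : (0 : ℝ) < p := by
        norm_num at hr26
        linarith
      exact_mod_cast this
    have h4 : 112 * p ^ 2 + 18 * p ≤ n := by
      have : (112 : ℝ) * p ^ 2 + 18 * p ≤ n := by
        rw [← hr2]
        have h5 : (p : ℝ) ^ 2 ≤ (0.0944 * r) ^ 2 := pow_le_pow_left₀ (Nat.cast_nonneg p) h1 2
        norm_num at hr26
        nlinarith
      exact_mod_cast this
    obtain ⟨H, hH, h5⟩ := exists_noRepeatedCycleLengths h3 h4
    have h6 : n + 16 * p ≤ G.edgeSet.ncard + 2 := h5 ▸ Nat.add_le_add_right (hmax H hH) 2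
    have h7 : (n : ℝ) + 16 * p ≤ G.edgeSet.ncard + 2 := by exact_mod_cast h6
    norm_num at hr26
    linarith
  by_contra! hlt
  obtain ⟨c', hc'⟩ := hc.exists_cyclicParam
  obtain ⟨k, hk1, hk2⟩ := hc'.exists_ncard_le hG (by simpa using hr26)
  rw [Fintype.card_fin, ← hr] at hk2
  have hk3 : (k : ℝ) + c.length ≤ G.edgeSet.ncard + 1 := by exact_mod_cast hk1
  have hs : √(k : ℝ) ^ 2 = k := Real.sq_sqrt (Nat.cast_nonneg k)
  have hs0 := Real.sqrt_nonneg (k : ℝ)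
  norm_num at hr26
  have h1 : 0.2524 * r ≤ √(k : ℝ) := by linarith
  have h2 : √(k : ℝ) ^ 2 ≤ r ^ 2 / 16 + 1.005 * r + 2 * √(k : ℝ) + 2 := by linarith
  nlinarith
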